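/- Let k be a cubic field. Then there exists an element u of Z_k, coprime to 2 (i.e., u*Z_k + 2*Z_k = Z_k), such that u*Z_k is the square of an ideal of Z_k, N_{k/QQ}(u) is a square in QQ, and u is not congruent to 1 modulo 4*Z_k. -/

import Mathlib

open NumberField

open NumberField
namespace Cub
open Complex Filter Topology

/-- `e(x) = exp(2 pi i x)`. -/
noncomputable def ee (x : ℚ) : ℂ := Complex.exp (2 * Real.pi * Complex.I * (x : ℂ))

lemma ee_add (x y : ℚ) : ee (x + y) = ee x * ee y := by
  rw [ee, ee, ee, ← Complex.exp_add]; push_cast; ring_nf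

lemma ee_int (n : ℤ) : ee n = 1 := by
  rw [ee]
  have := Complex.exp_int_mul_two_pi_mul_I n
  rw [← this]; push_cast; ring_nf

lemma ee_add_int (x : ℚ) (n : ℤ) : ee (x + n) = ee x := by
  rw [ee_add, ee_int, mul_one]

lemma ee_zero : ee 0 = 1 := by simpa using ee_int 0

lemma ee_neg (x : ℚ) : ee (-x) = (starRingEnd ℂ) (ee x) := by
  rw [ee, ee, ← Complex.exp_conj]
  congr 1
  have h2 : (starRingEnd ℂ) 2 = 2 := Complex.conj_ofNat 2
  simp [h2]

lemma ee_sum {ι : Type*} (s : Finset ι) (f : ι → ℚ) : ee (∑ i ∈ s, f i) = ∏ i ∈ s, ee (f i) := by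
  classical
  induction s using Finset.induction_on with
  | empty => simp [ee_zero]
  | insert a s ha ih => rw [Finset.sum_insert ha, Finset.prod_insert ha, ee_add, ih]

lemma tendsto_kernel (x : ℝ) :
    Tendsto (fun t : ℝ => ((Real.sqrt t * HurwitzZeta.evenKernel (x : UnitAddCircle) t : ℝ) : ℂ))
      (𝓝[>] 0) (𝓝 1) := by
  have h1 : Tendsto (fun t : ℝ => HurwitzZeta.cosKernel (x : UnitAddCircle) t) atTop (𝓝 1) := by
    obtain ⟨p, hp, h⟩ := HurwitzZeta.isBigO_atTop_cosKernel_sub (x : UnitAddCircle)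
    have : Tendsto (fun t : ℝ => HurwitzZeta.cosKernel (x : UnitAddCircle) t - 1) atTop (𝓝 0) := by
      apply h.trans_tendsto
      apply Real.tendsto_exp_atBot.comp
      have : Tendsto (fun t : ℝ => p * t) atTop atTop := tendsto_id.const_mul_atTop hp
      refine (tendsto_neg_atTop_atBot.comp this).congr fun t => ?_
      simp
    simpa using this.add_const 1
  have h2 := h1.comp tendsto_inv_nhdsGT_zero
  rw [show (1:ℂ) = ((1:ℝ):ℂ) by simp]
  refine (Complex.continuous_ofReal.tendsto 1).comp (h2.congr' ?_)
  filter_upwards [self_mem_nhdsWithin] with t ht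
  have ht' : (0:ℝ) < t := ht
  rw [HurwitzZeta.evenKernel_functional_equation, ← Real.sqrt_eq_rpow]
  have := Real.sqrt_pos.2 ht'
  simp only [Function.comp, one_div]
  field_simp

lemma theta_split (a : ℕ) (ha : 0 < a) {t : ℝ} (ht : 0 < t) :
    jacobiTheta (1 / (2 * a) + t * I) = ∑ r : Fin (2 * a), ee ((r : ℚ) ^ 2 / (4 * a)) *
      (HurwitzZeta.evenKernel (((r : ℝ) / (2 * a) : ℝ) : UnitAddCircle) (4 * a ^ 2 * t) : ℝ) := by
  have : NeZero (2 * a) := ⟨by omega⟩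
  have ha' : (a : ℝ) ≠ 0 := by positivity
  have ha'' : (a : ℂ) ≠ 0 := by exact_mod_cast ha.ne'
  have him : 0 < (1 / (2 * a) + t * I : ℂ).im := by
    have : (1 / (2 * a) : ℂ).im = 0 := by
      have : (1 / (2 * a) : ℂ) = ((1 / (2 * a) : ℝ) : ℂ) := by push_cast; ring
      rw [this, ofReal_im]
    simpa [this] using ht
  have hs := hasSum_jacobiTheta₂_term 0 him
  rw [← jacobiTheta_eq_jacobiTheta₂] at hs
  rw [← (Int.divModEquiv (2 * a)).symm.hasSum_iff, ← (Equiv.prodComm _ _).hasSum_iff] at hs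
  have hf : ∀ r : Fin (2 * a), HasSum (fun m : ℤ =>
      ((jacobiTheta₂_term · 0 (1 / (2 * a) + t * I)) ∘ (Int.divModEquiv (2 * a)).symm ∘
        (Equiv.prodComm _ _)) (r, m)) (ee ((r : ℚ) ^ 2 / (4 * a)) *
      (HurwitzZeta.evenKernel (((r : ℝ) / (2 * a) : ℝ) : UnitAddCircle) (4 * a ^ 2 * t) : ℝ)) := by
    intro r
    have h1 := (Complex.hasSum_ofReal.2 (HurwitzZeta.hasSum_int_evenKernel ((r : ℝ) / (2 * a))
      (t := 4 * a ^ 2 * t) (by positivity))).mul_left (ee ((r : ℚ) ^ 2 / (4 * a)))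
    refine h1.congr_fun ?_
    intro m
    simp only [Function.comp, Equiv.prodComm_apply, Prod.swap_prod_mk, Int.divModEquiv_symm_apply,
      jacobiTheta₂_term, ee]
    rw [Complex.ofReal_exp, ← Complex.exp_add, Complex.exp_eq_exp_iff_exists_int]
    refine ⟨a * m ^ 2 + m * r, ?_⟩
    push_cast
    have hI : I ^ 2 = -1 := Complex.I_sq
    field_simp
    ring_nf
    simp only [hI]
    ring
  have h2 := hs.prod_fiberwise hf
  exact (h2.unique (hasSum_fintype _))


lemma cpow_half_mul {t : ℝ} (ht : 0 < t) {z : ℂ} (hz : z ≠ 0) :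
    ((t : ℂ) * z) ^ (1 / 2 : ℂ) = (Real.sqrt t : ℂ) * z ^ (1 / 2 : ℂ) := by
  have ht' : (t : ℂ) ≠ 0 := by exact_mod_cast ht.ne'
  rw [cpow_def_of_ne_zero (mul_ne_zero ht' hz), cpow_def_of_ne_zero hz, log_ofReal_mul ht hz,
    add_mul, Complex.exp_add, Real.sqrt_eq_rpow, Real.rpow_def_of_pos ht]
  push_cast
  ring_nf

lemma theta_fe (τ : ℂ) : jacobiTheta τ = 1 / (-I * τ) ^ (1 / 2 : ℂ) * jacobiTheta (-1 / τ) := by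
  rw [jacobiTheta_eq_jacobiTheta₂, jacobiTheta_eq_jacobiTheta₂,
    jacobiTheta₂_functional_equation 0 τ]
  simp

lemma theta_period (n : ℕ) (τ : ℂ) : jacobiTheta (τ - 2 * n) = jacobiTheta τ := by
  induction n with
  | zero => simp
  | succ n ih =>
    rw [← ih, ← jacobiTheta_two_add]
    congr 1; push_cast; ring

lemma theta_limit (a : ℕ) (ha : 0 < a) :
    Tendsto (fun t : ℝ => (Real.sqrt t : ℂ) * jacobiTheta (1 / (2 * a) + t * I)) (𝓝[>] 0)
      (𝓝 (1 / (-I * (1 / (2 * a))) ^ (1 / 2 : ℂ) * (1 / (2 * a / (1 / (2 * a))) ^ (1 / 2 : ℂ)))) := by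
  have ha' : (a : ℂ) ≠ 0 := by exact_mod_cast ha.ne'
  have har : (0 : ℝ) < a := by exact_mod_cast ha
  have hre : ∀ t : ℝ, (1 / (2 * a) + t * I : ℂ) = ((1 / (2 * a) : ℝ) : ℂ) + t * I := by
    intro t; push_cast; ring
  have hτ0 : ∀ t : ℝ, (1 / (2 * a) + t * I : ℂ) ≠ 0 := by
    intro t h
    have := congrArg Complex.re h
    rw [hre] at this
    simp at this
    omega
  have hcont : Tendsto (fun t : ℝ => (1 / (2 * a) + t * I : ℂ)) (𝓝[>] 0) (𝓝 (1 / (2 * a))) := by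
    have : Continuous (fun t : ℝ => (1 / (2 * a) + t * I : ℂ)) := by fun_prop
    simpa using (this.tendsto 0).mono_left nhdsWithin_le_nhds
  have key : ∀ t : ℝ, 0 < t → (Real.sqrt t : ℂ) * jacobiTheta (1 / (2 * a) + t * I) =
      1 / (-I * (1 / (2 * a) + t * I)) ^ (1 / 2 : ℂ) *
      (1 / (2 * a / (1 / (2 * a) + t * I)) ^ (1 / 2 : ℂ)) *
      jacobiTheta (((1 / (4 * a ^ 2) * t⁻¹ : ℝ) : ℂ) * I - ((1 / (2 * a) : ℝ) : ℂ)) := by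
    intro t ht
    have ht' : (t : ℂ) ≠ 0 := by exact_mod_cast ht.ne'
    have hs : (Real.sqrt t : ℂ) ≠ 0 := by exact_mod_cast (Real.sqrt_pos.2 ht).ne'
    set τ : ℂ := 1 / (2 * a) + t * I with hτ
    have h0 := hτ0 t
    rw [← hτ] at h0
    have e1 : -1 / τ = (2 * a * I * t / τ) - 2 * a := by
      have : τ * (2 * a) = 1 + 2 * a * I * t := by rw [hτ]; field_simp
      rw [div_eq_iff h0, sub_mul, div_mul_cancel₀ _ h0]
      linear_combination this
    have e2 : -I * (2 * a * I * t / τ) = (t : ℂ) * (2 * a / τ) := by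
      have hI : I ^ 2 = -1 := Complex.I_sq
      field_simp
      linear_combination (-1 : ℂ) * hI
    have e3 : -1 / (2 * a * I * t / τ) =
        ((1 / (4 * a ^ 2) * t⁻¹ : ℝ) : ℂ) * I - ((1 / (2 * a) : ℝ) : ℂ) := by
      have hI : I ^ 2 = -1 := Complex.I_sq
      rw [hτ]
      push_cast
      field_simp
      ring_nf
      simp only [hI]
      ring
    have h3 : (2 * a / τ : ℂ) ≠ 0 := div_ne_zero (mul_ne_zero two_ne_zero ha') h0
    rw [theta_fe τ, e1, theta_period, theta_fe (2 * a * I * t / τ), e2, e3, cpow_half_mul ht h3]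
    field_simp
  have hth : Tendsto (fun t : ℝ =>
      jacobiTheta (((1 / (4 * a ^ 2) * t⁻¹ : ℝ) : ℂ) * I - ((1 / (2 * a) : ℝ) : ℂ)))
      (𝓝[>] 0) (𝓝 1) := by
    have hb : Tendsto (fun τ : ℂ => jacobiTheta τ - 1) (comap im atTop) (𝓝 0) := by
      apply isBigO_at_im_infty_jacobiTheta_sub_one.trans_tendsto
      apply Real.tendsto_exp_atBot.comp
      have h1 : Tendsto (fun τ : ℂ => Real.pi * τ.im) (comap im atTop) atTop :=
        tendsto_comap.const_mul_atTop Real.pi_pos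
      refine (tendsto_neg_atTop_atBot.comp h1).congr fun t => ?_
      simp
    have hb' : Tendsto (fun τ : ℂ => jacobiTheta τ) (comap im atTop) (𝓝 1) := by
      simpa using hb.add_const 1
    apply hb'.comp
    rw [tendsto_comap_iff]
    have h2 : Tendsto (fun t : ℝ => 1 / (4 * a ^ 2) * t⁻¹) (𝓝[>] (0:ℝ)) atTop :=
      tendsto_inv_nhdsGT_zero.const_mul_atTop (by positivity)
    refine h2.congr fun t => ?_
    simp only [Function.comp, sub_im, mul_im, ofReal_re, ofReal_im, I_re, I_im]
    ring
  have hsl1 : (-I * (1 / (2 * a)) : ℂ) ∈ slitPlane := by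
    right
    have : (-I * (1 / (2 * a)) : ℂ) = ((-(1 / (2 * a)) : ℝ) : ℂ) * I := by push_cast; ring
    rw [this]
    simp
    omega
  have hsl2 : (2 * a / (1 / (2 * a)) : ℂ) ∈ slitPlane := by
    left
    have : (2 * a / (1 / (2 * a)) : ℂ) = ((4 * a ^ 2 : ℝ) : ℂ) := by push_cast; field_simp; ring
    rw [this, ofReal_re]
    positivity
  have l1 := (hcont.const_mul (-I)).cpow (tendsto_const_nhds (x := (1 / 2 : ℂ))) hsl1
  have l2 := ((tendsto_const_nhds (x := (2 * a : ℂ))).div hcont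
    (by simpa using ha')).cpow (tendsto_const_nhds (x := (1 / 2 : ℂ))) hsl2
  have n1 : (-I * (1 / (2 * a)) : ℂ) ^ (1 / 2 : ℂ) ≠ 0 := by
    rw [Ne, cpow_eq_zero_iff]; simp; intro h; exact absurd h ha.ne'
  have n2 : (2 * a / (1 / (2 * a)) : ℂ) ^ (1 / 2 : ℂ) ≠ 0 := by
    rw [Ne, cpow_eq_zero_iff]; simp; intro h; exact absurd h ha.ne'
  have l3 := (((tendsto_const_nhds (x := (1 : ℂ))).div l1 n1).mul
    ((tendsto_const_nhds (x := (1 : ℂ))).div l2 n2)).mul hth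
  rw [mul_one] at l3
  refine l3.congr' ?_
  filter_upwards [self_mem_nhdsWithin] with t ht
  exact (key t ht).symm

lemma gauss_pos (a : ℕ) (ha : 0 < a) : ∃ c : ℝ, 0 < c ∧
    ∑ r : Fin (2 * a), ee ((r : ℚ) ^ 2 / (4 * a)) = c * ee (1 / 8) := by
  have ha' : (a : ℂ) ≠ 0 := by exact_mod_cast ha.ne'
  have har : (0 : ℝ) < a := by exact_mod_cast ha
  have h1 : Tendsto (fun t : ℝ => (Real.sqrt t : ℂ) * jacobiTheta (1 / (2 * a) + t * I)) (𝓝[>] 0)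
      (𝓝 ((1 / (2 * a)) * ∑ r : Fin (2 * a), ee ((r : ℚ) ^ 2 / (4 * a)))) := by
    have hsc : Tendsto (fun t : ℝ => 4 * a ^ 2 * t) (𝓝[>] 0) (𝓝[>] 0) := by
      rw [tendsto_nhdsWithin_iff]
      constructor
      · have : Continuous (fun t : ℝ => 4 * a ^ 2 * t) := by fun_prop
        simpa using (this.tendsto 0).mono_left nhdsWithin_le_nhds
      · filter_upwards [self_mem_nhdsWithin] with t ht
        have : (0:ℝ) < t := ht
        show (0:ℝ) < _
        positivity
    have h2 : Tendsto (fun t : ℝ => ∑ r : Fin (2 * a), (1 / (2 * a)) * ee ((r : ℚ) ^ 2 / (4 * a)) *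
        ((Real.sqrt (4 * a ^ 2 * t) * HurwitzZeta.evenKernel
          (((r : ℝ) / (2 * a) : ℝ) : UnitAddCircle) (4 * a ^ 2 * t) : ℝ) : ℂ)) (𝓝[>] 0)
        (𝓝 (∑ r : Fin (2 * a), (1 / (2 * a)) * ee ((r : ℚ) ^ 2 / (4 * a)) * 1)) := by
      apply tendsto_finsetSum
      intro r _
      exact ((tendsto_kernel _).comp hsc).const_mul _
    rw [Finset.mul_sum]
    simp only [mul_one] at h2
    refine h2.congr' ?_
    filter_upwards [self_mem_nhdsWithin] with t ht
    have ht' : (0:ℝ) < t := ht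
    rw [theta_split a ha ht', Finset.mul_sum]
    refine Finset.sum_congr rfl fun r _ => ?_
    rw [Real.sqrt_mul (by positivity), show (4 * a ^ 2 : ℝ) = (2 * a) ^ 2 by ring,
      Real.sqrt_sq (by positivity)]
    push_cast
    field_simp
  have h3 := tendsto_nhds_unique h1 (theta_limit a ha)
  have e1 : (-I * (1 / (2 * a)) : ℂ) ^ (1 / 2 : ℂ) =
      (Real.sqrt (1 / (2 * a)) : ℂ) * ee (-(1 / 8)) := by
    have : (-I * (1 / (2 * a)) : ℂ) = ((1 / (2 * a) : ℝ) : ℂ) * (-I) := by push_cast; ring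
    rw [this, cpow_half_mul (by positivity) (by simp), cpow_def_of_ne_zero (by simp), log_neg_I, ee]
    push_cast
    ring_nf
  have e2 : (2 * a / (1 / (2 * a)) : ℂ) ^ (1 / 2 : ℂ) = (Real.sqrt (4 * a ^ 2) : ℂ) := by
    have : (2 * a / (1 / (2 * a)) : ℂ) = ((4 * a ^ 2 : ℝ) : ℂ) * 1 := by push_cast; field_simp; ring
    rw [this, cpow_half_mul (by positivity) one_ne_zero]
    simp
  have e3 : ee (-(1/8)) * ee (1/8) = 1 := by rw [← ee_add]; simp [ee_zero]
  rw [e1, e2] at h3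
  refine ⟨2 * a * (1 / Real.sqrt (1 / (2 * a))) * (1 / Real.sqrt (4 * a ^ 2)), by positivity, ?_⟩
  have n1 : ((Real.sqrt (1 / (2 * a)) : ℝ) : ℂ) ≠ 0 := by
    have : 0 < Real.sqrt (1 / (2 * a)) := by positivity
    exact_mod_cast this.ne'
  have n2 : ((Real.sqrt (4 * a ^ 2) : ℝ) : ℂ) ≠ 0 := by
    have : 0 < Real.sqrt (4 * a ^ 2) := by positivity
    exact_mod_cast this.ne'
  have n3 : ee (-(1/8)) ≠ 0 := left_ne_zero_of_mul_eq_one e3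
  have e4 : ee (1/8) = 1 / ee (-(1/8)) := by field_simp; rw [mul_comm]; exact e3
  rw [e4]
  push_cast
  rw [one_div_mul_eq_div, div_eq_iff (by simpa using ha')] at h3
  rw [h3]
  field_simp

/-- one dimensional Gauss sums up to positive reals -/
lemma gauss_one (a : ℤ) (ha : a ≠ 0) : ∃ c : ℝ, 0 < c ∧
    ∑ r : Fin (2 * a.natAbs), ee (a * ((r : ℚ) / (2 * a)) ^ 2) = c * ee ((a.sign : ℚ) / 8) := by
  obtain ⟨c, hc, h⟩ := gauss_pos a.natAbs (Int.natAbs_pos.2 ha)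
  refine ⟨c, hc, ?_⟩
  have hq : (a : ℚ) ≠ 0 := by exact_mod_cast ha
  rcases lt_or_gt_of_ne ha with h0 | h0
  · have e : (a.natAbs : ℚ) = -(a : ℚ) := by
      have h5 : (a.natAbs : ℤ) = -a := by omega
      rw [← Int.cast_natCast, h5]; push_cast; ring
    have := congrArg (starRingEnd ℂ) h
    rw [map_sum, map_mul, Complex.conj_ofReal, ← ee_neg] at this
    rw [Int.sign_eq_neg_one_of_neg h0]
    push_cast
    rw [show (-1 / 8 : ℚ) = -(1/8) by ring, ← this]
    refine Finset.sum_congr rfl fun r _ => ?_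
    rw [← ee_neg, e]
    congr 1
    field_simp
    try norm_num
  · have e : (a.natAbs : ℚ) = (a : ℚ) := by
      have h5 : (a.natAbs : ℤ) = a := by omega
      rw [← Int.cast_natCast, h5]
    rw [Int.sign_eq_one_of_pos h0]
    push_cast
    rw [← h]
    refine Finset.sum_congr rfl fun r _ => ?_
    rw [e]
    congr 1
    field_simp
    try norm_num

end Cub

open NumberField
namespace Cub

/-- rational number is an integer -/
def IsI (x : ℚ) : Prop := ∃ n : ℤ, x = n

lemma IsI.add {x y : ℚ} (hx : IsI x) (hy : IsI y) : IsI (x + y) := by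
  obtain ⟨n, rfl⟩ := hx; obtain ⟨m, rfl⟩ := hy; exact ⟨n + m, by push_cast; ring⟩

lemma IsI.sub {x y : ℚ} (hx : IsI x) (hy : IsI y) : IsI (x - y) := by
  obtain ⟨n, rfl⟩ := hx; obtain ⟨m, rfl⟩ := hy; exact ⟨n - m, by push_cast; ring⟩

lemma IsI.mul {x y : ℚ} (hx : IsI x) (hy : IsI y) : IsI (x * y) := by
  obtain ⟨n, rfl⟩ := hx; obtain ⟨m, rfl⟩ := hy; exact ⟨n * m, by push_cast; ring⟩

lemma IsI.sum {ι : Type*} (s : Finset ι) (f : ι → ℚ) (h : ∀ i ∈ s, IsI (f i)) :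
    IsI (∑ i ∈ s, f i) := by
  classical
  induction s using Finset.induction_on with
  | empty => exact ⟨0, by simp⟩
  | insert a s ha ih =>
    rw [Finset.sum_insert ha]
    exact (h a (by simp)).add (ih fun i hi => h i (by simp [hi]))

lemma isI_int (n : ℤ) : IsI n := ⟨n, rfl⟩

lemma ee_add_isI (x : ℚ) {y : ℚ} (h : IsI y) : ee (x + y) = ee x := by
  obtain ⟨n, rfl⟩ := h; exact ee_add_int x n

lemma ee_isI {y : ℚ} (h : IsI y) : ee y = 1 := by
  obtain ⟨n, rfl⟩ := h; exact ee_int n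

lemma ee_eq_one {x : ℚ} (h : ee x = 1) : IsI x := by
  rw [ee, Complex.exp_eq_one_iff] at h
  obtain ⟨n, hn⟩ := h
  refine ⟨n, ?_⟩
  have hp : (2 * Real.pi * Complex.I : ℂ) ≠ 0 := Complex.two_pi_I_ne_zero
  have : (x : ℂ) = n := mul_left_cancel₀ hp (by rw [hn]; ring)
  exact_mod_cast this

variable {V : Type*} [AddCommGroup V]

/-- `r` is a transversal for `Λ / L`. -/
structure IsTrv (Λ L : AddSubgroup V) {ι : Type*} (r : ι → V) : Prop where
  mem : ∀ i, r i ∈ Λ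
  ex : ∀ x ∈ Λ, ∃ i, x - r i ∈ L
  inj : ∀ i j, r i - r j ∈ L → i = j

lemma IsTrv.sum_eq {Λ L : AddSubgroup V} {ι κ : Type*} [Fintype ι] [Fintype κ] {r : ι → V}
    {s : κ → V} (hr : IsTrv Λ L r) (hs : IsTrv Λ L s) (f : V → ℂ)
    (hf : ∀ x ∈ Λ, ∀ l ∈ L, f (x + l) = f x) : ∑ i, f (r i) = ∑ j, f (s j) := by
  choose g hg using fun i => hs.ex (r i) (hr.mem i)
  refine Fintype.sum_bijective g ⟨?_, ?_⟩ _ _ ?_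
  · intro i j hij
    apply hr.inj
    have h1 := hg i
    have h2 := hg j
    rw [hij] at h1
    have := L.sub_mem h1 h2
    simpa using this
  · intro j
    obtain ⟨i, hi⟩ := hr.ex (s j) (hs.mem j)
    refine ⟨i, ?_⟩
    apply hs.inj
    have := L.add_mem hi (hg i)
    have := L.neg_mem this
    simpa using this
  · intro i
    have := hf (s (g i)) (hs.mem _) _ (hg i)
    rw [← this]; congr 1; abel

lemma IsTrv.comp {Λ L' L : AddSubgroup V} (h1 : L ≤ L') (h2 : L' ≤ Λ) {ι κ : Type*} {r : ι → V}
    {s : κ → V} (hr : IsTrv Λ L' r) (hs : IsTrv L' L s) :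
    IsTrv Λ L (fun p : ι × κ => r p.1 + s p.2) where
  mem p := Λ.add_mem (hr.mem _) (h2 (hs.mem _))
  ex x hx := by
    obtain ⟨i, hi⟩ := hr.ex x hx
    obtain ⟨j, hj⟩ := hs.ex _ hi
    exact ⟨(i, j), by simpa [sub_sub] using hj⟩
  inj := by
    rintro ⟨i, j⟩ ⟨i', j'⟩ h
    have e : i = i' := by
      apply hr.inj
      have h3 := L'.sub_mem (h1 h) (L'.sub_mem (hs.mem j) (hs.mem j'))
      convert h3 using 1
      simp only; abel
    subst e
    have : j = j' := by
      apply hs.inj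
      convert h using 1
      simp only; abel
    rw [this]

lemma IsTrv.exists_of_finite (Λ L : AddSubgroup V) (h : L.relIndex Λ ≠ 0) :
    ∃ (n : ℕ) (r : Fin n → V), IsTrv Λ L r := by
  have hfi : (L.addSubgroupOf Λ).FiniteIndex := ⟨h⟩
  have hfin : Finite (Λ ⧸ L.addSubgroupOf Λ) := AddSubgroup.finite_quotient_of_finiteIndex
  obtain ⟨n, ⟨e⟩⟩ := Finite.exists_equiv_fin (Λ ⧸ L.addSubgroupOf Λ)
  refine ⟨n, fun i => ((Quotient.out (e.symm i) : Λ) : V), fun i => Subtype.mem _, ?_, ?_⟩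
  · intro x hx
    refine ⟨e (QuotientAddGroup.mk ⟨x, hx⟩), ?_⟩
    have h1 : (QuotientAddGroup.mk (s := L.addSubgroupOf Λ) (Quotient.out
      (QuotientAddGroup.mk (s := L.addSubgroupOf Λ) (⟨x, hx⟩ : Λ)))) =
      QuotientAddGroup.mk ⟨x, hx⟩ := QuotientAddGroup.out_eq' _
    rw [QuotientAddGroup.eq, AddSubgroup.mem_addSubgroupOf] at h1
    simp only [Equiv.symm_apply_apply]
    convert h1 using 1
    simp; abel
  · intro i j hij
    apply e.symm.injective
    rw [← QuotientAddGroup.out_eq' (e.symm i), ← QuotientAddGroup.out_eq' (e.symm j),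
      QuotientAddGroup.eq, AddSubgroup.mem_addSubgroupOf]
    have := L.neg_mem hij
    convert this using 1
    simp; abel

lemma IsTrv.relIndex_ne_zero {Λ L : AddSubgroup V} {ι : Type*} [Finite ι] {r : ι → V}
    (hr : IsTrv Λ L r) : L.relIndex Λ ≠ 0 := by
  have : Finite (Λ ⧸ L.addSubgroupOf Λ) := by
    refine Finite.of_surjective (fun i : ι => QuotientAddGroup.mk (⟨r i, hr.mem i⟩ : Λ)) ?_
    intro x
    obtain ⟨x, rfl⟩ := QuotientAddGroup.mk_surjective x
    obtain ⟨i, hi⟩ := hr.ex x x.2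
    refine ⟨i, ?_⟩
    rw [QuotientAddGroup.eq, AddSubgroup.mem_addSubgroupOf]
    convert hi using 1
    simp; abel
  exact AddSubgroup.index_ne_zero_of_finite

/-- a quadratic map with its polar form -/
structure QData (q : V → ℚ) (B : V → V → ℚ) : Prop where
  add : ∀ x y, q (x + y) = q x + q y + B x y
  left : ∀ x y z, B (x + y) z = B x z + B y z
  right : ∀ x y z, B x (y + z) = B x y + B x z

variable {q : V → ℚ} {B : V → V → ℚ}

lemma charSum_zero (hq : QData q B) {L' L : AddSubgroup V} {κ : Type*} [Fintype κ] {s : κ → V}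
    (hs : IsTrv L' L s) (x : V) (hx : ∀ y ∈ L, IsI (B x y)) (hx' : ¬ ∀ y ∈ L', IsI (B x y)) :
    ∑ j, ee (B x (s j)) = 0 := by
  push Not at hx'
  obtain ⟨y, hy, hxy⟩ := hx'
  have ht : IsTrv L' L (fun j => s j + y) := by
    refine ⟨fun j => L'.add_mem (hs.mem j) hy, fun z hz => ?_, fun i j h => hs.inj i j ?_⟩
    · obtain ⟨j, hj⟩ := hs.ex (z - y) (L'.sub_mem hz hy)
      refine ⟨j, ?_⟩
      convert hj using 1
      abel
    · simpa using h
  have h := hs.sum_eq ht (fun z => ee (B x z)) (by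
    intro z _ l hl
    rw [hq.right, ee_add_isI _ (hx l hl)])
  simp only [hq.right, ee_add, ← Finset.sum_mul] at h
  have h1 : ee (B x y) ≠ 1 := fun h' => hxy (ee_eq_one h')
  have h2 : (∑ j, ee (B x (s j))) * (ee (B x y) - 1) = 0 := by rw [mul_sub, ← h]; ring
  rcases mul_eq_zero.1 h2 with h3 | h3
  · exact h3
  · exact absurd (sub_eq_zero.1 h3) h1

lemma milgram_step (hq : QData q B) {Λ Λ' L' L : AddSubgroup V} (hLL : L ≤ L')
    (hInt : ∀ x ∈ L', IsI (q x))
    (hΛ : ∀ x, x ∈ Λ ↔ ∀ y ∈ L, IsI (B x y)) (hΛ' : ∀ x, x ∈ Λ' ↔ ∀ y ∈ L', IsI (B x y))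
    {ι κ : Type*} [Fintype ι] [Fintype κ] {r : ι → V} {r' : κ → V}
    (hr : IsTrv Λ L r) (hr' : IsTrv Λ' L' r') :
    ∃ c : ℝ, 0 < c ∧ ∑ i, ee (q (r i)) = c * ∑ j, ee (q (r' j)) := by
  classical
  have hL'Λ' : L' ≤ Λ' := by
    intro x hx
    rw [hΛ']
    intro y hy
    have : B x y = q (x + y) - q x - q y := by rw [hq.add]; ring
    rw [this]
    exact ((hInt _ (L'.add_mem hx hy)).sub (hInt x hx)).sub (hInt y hy)
  have hΛΛ : Λ' ≤ Λ := by
    intro x hx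
    rw [hΛ]
    exact fun y hy => (hΛ' x).1 hx y (hLL hy)
  have hL'Λ := hL'Λ'.trans hΛΛ
  have hfin := hr.relIndex_ne_zero
  have hm := AddSubgroup.relIndex_mul_relIndex L L' Λ hLL hL'Λ
  rw [← hm] at hfin
  obtain ⟨n, s, hs⟩ := IsTrv.exists_of_finite L' L (left_ne_zero_of_mul hfin)
  obtain ⟨m, w, hw⟩ := IsTrv.exists_of_finite Λ L' (right_ne_zero_of_mul hfin)
  have h1 := hr.sum_eq (hw.comp hLL hL'Λ hs) (fun x => ee (q x)) (by
    intro x hx l hl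
    rw [hq.add, add_assoc, ee_add_isI _ ((hInt l (hLL hl)).add ((hΛ x).1 hx l hl))])
  simp only [Fintype.sum_prod_type] at h1
  have h2 : ∀ i, ∑ j, ee (q (w i + s j)) = if w i ∈ Λ' then (n : ℂ) * ee (q (w i)) else 0 := by
    intro i
    have : ∀ j, ee (q (w i + s j)) = ee (q (w i)) * ee (B (w i) (s j)) := by
      intro j
      rw [hq.add, add_right_comm, ee_add_isI _ (hInt _ (hs.mem j)), ee_add]
    simp only [this, ← Finset.mul_sum]
    split_ifs with h
    · have : ∀ j, ee (B (w i) (s j)) = 1 := fun j => ee_isI ((hΛ' _).1 h _ (hs.mem j))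
      simp [this, mul_comm]
    · rw [charSum_zero hq hs (w i) ((hΛ _).1 (hw.mem i)) (fun h' => h ((hΛ' _).2 h')), mul_zero]
  have ht : IsTrv Λ' L' (fun i : {i // w i ∈ Λ'} => w i) := by
    refine ⟨fun i => i.2, fun x hx => ?_, fun i j h => Subtype.ext (hw.inj _ _ h)⟩
    obtain ⟨i, hi⟩ := hw.ex x (hΛΛ hx)
    refine ⟨⟨i, ?_⟩, hi⟩
    have := Λ'.sub_mem hx (hL'Λ' hi)
    simpa using this
  have h3 := hr'.sum_eq ht (fun x => ee (q x)) (by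
    intro x hx l hl
    rw [hq.add, add_assoc, ee_add_isI _ ((hInt l hl).add ((hΛ' x).1 hx l hl))])
  have hn : n ≠ 0 := by
    rintro rfl
    obtain ⟨j, -⟩ := hs.ex 0 L'.zero_mem
    exact j.elim0
  refine ⟨n, by positivity, ?_⟩
  rw [h1, h3]
  simp only [h2]
  rw [← Finset.sum_filter, Finset.mul_sum]
  simp only [Complex.ofReal_natCast]
  rw [Finset.sum_subtype (p := fun i => w i ∈ Λ') (Finset.univ.filter fun i => w i ∈ Λ') (by simp)
    (fun i => (n : ℂ) * ee (q (w i)))]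

/-- Milgram's formula up to a positive real factor, for a form diagonal in the basis `b`. -/
lemma milgram {ι : Type*} [Fintype ι] [Module ℚ V] (hq : QData q B) (b : Module.Basis ι ℚ V)
    (a : ι → ℤ) (ha : ∀ i, a i ≠ 0) (hqb : ∀ x, q x = ∑ i, a i * (b.repr x i) ^ 2)
    (hBb : ∀ x y, B x y = ∑ i, 2 * a i * (b.repr x i) * (b.repr y i))
    {Λ L : AddSubgroup V} (hbL : ∀ i, b i ∈ L) (hInt : ∀ x ∈ L, IsI (q x))
    (hΛ : ∀ x, x ∈ Λ ↔ ∀ y ∈ L, IsI (B x y))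
    {κ : Type*} [Fintype κ] {r : κ → V} (hr : IsTrv Λ L r) :
    ∃ c : ℝ, 0 < c ∧ ∑ i, ee (q (r i)) = c * ee (∑ i, ((a i).sign : ℚ) / 8) := by
  classical
  have haq : ∀ i, (a i : ℚ) ≠ 0 := fun i => by exact_mod_cast ha i
  let L0 : AddSubgroup V :=
    { carrier := {x | ∀ i, IsI (b.repr x i)}
      zero_mem' := fun i => ⟨0, by simp⟩
      add_mem' := fun {x y} hx hy i => by simpa using (hx i).add (hy i)
      neg_mem' := fun {x} hx i => by simpa using (isI_int 0).sub (hx i) }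
  let Λ0 : AddSubgroup V :=
    { carrier := {x | ∀ i, IsI (2 * a i * b.repr x i)}
      zero_mem' := fun i => ⟨0, by simp⟩
      add_mem' := fun {x y} hx hy i => by simpa [mul_add] using (hx i).add (hy i)
      neg_mem' := fun {x} hx i => by simpa using (isI_int 0).sub (hx i) }
  have hL0 : L0 ≤ L := by
    intro x hx
    rw [← b.sum_repr x]
    refine L.sum_mem fun i _ => ?_
    obtain ⟨n, hn⟩ := hx i
    rw [hn, Int.cast_smul_eq_zsmul]
    exact L.zsmul_mem (hbL i) n
  have hΛ0 : ∀ x, x ∈ Λ0 ↔ ∀ y ∈ L0, IsI (B x y) := by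
    intro x
    constructor
    · intro hx y hy
      rw [hBb]
      exact IsI.sum _ _ fun i _ => (hx i).mul (hy i)
    · intro hx i
      have h1 := hx (b i) (fun j => by
        rw [b.repr_self, Finsupp.single_apply]
        split_ifs
        · exact ⟨1, by simp⟩
        · exact ⟨0, by simp⟩)
      rw [hBb] at h1
      simpa [b.repr_self, Finsupp.single_apply] using h1
  let r0 : ((i : ι) → Fin (2 * (a i).natAbs)) → V := fun f => ∑ i, ((f i : ℚ) / (2 * a i)) • b i
  have hr0r : ∀ f i, b.repr (r0 f) i = (f i : ℚ) / (2 * a i) := by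
    intro f i
    simp only [r0]
    rw [b.repr_sum_self]
  have hr0 : IsTrv Λ0 L0 r0 := by
    refine ⟨fun f i => ?_, fun x hx => ?_, fun f g h => ?_⟩
    · rw [hr0r]
      refine ⟨(f i : ℕ), ?_⟩
      have := haq i
      field_simp
      simp
    · choose n hn using hx
      have hpos : ∀ i, 0 < 2 * (a i).natAbs := fun i => by
        have := Int.natAbs_pos.2 (ha i); omega
      refine ⟨fun i => ⟨(n i % (2 * (a i).natAbs : ℕ)).toNat, ?_⟩, fun i => ?_⟩
      · have h1 := Int.emod_lt_of_pos (n i) (b := (2 * (a i).natAbs : ℕ)) (by exact_mod_cast hpos i)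
        have h2 := Int.emod_nonneg (n i) (b := (2 * (a i).natAbs : ℕ))
          (by exact_mod_cast (hpos i).ne')
        omega
      · have h2 := Int.emod_nonneg (n i) (b := (2 * (a i).natAbs : ℕ))
          (by exact_mod_cast (hpos i).ne')
        have h3 : b.repr x i = n i / (2 * a i) := by
          have := haq i
          rw [← hn i]; field_simp
        rw [map_sub, Finsupp.sub_apply, hr0r, h3]
        have h4 : (((n i % (2 * (a i).natAbs : ℕ)).toNat : ℕ) : ℤ) =
          n i % (2 * (a i).natAbs : ℕ) := Int.toNat_of_nonneg h2
        have h5 : (2 * a i) ∣ n i - n i % (2 * (a i).natAbs : ℕ) := by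
          have : ((2 * (a i).natAbs : ℕ) : ℤ) ∣ n i - n i % (2 * (a i).natAbs : ℕ) :=
            Int.dvd_self_sub_emod
          refine dvd_trans ?_ this
          push_cast
          rw [← abs_dvd_abs, abs_mul]; simp
        obtain ⟨m, hm⟩ := h5
        refine ⟨m, ?_⟩
        have h6 := congrArg (Int.cast : ℤ → ℚ) hm
        rw [← h4] at h6
        rw [Int.cast_sub, Int.cast_natCast, Int.cast_mul, Int.cast_mul, Int.cast_ofNat] at h6
        have := haq i
        rw [← sub_div, div_eq_iff (by positivity)]
        rw [show (m : ℚ) * (2 * a i) = 2 * a i * m by ring, ← h6]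
    · funext i
      obtain ⟨n, hn⟩ := h i
      rw [map_sub, Finsupp.sub_apply, hr0r, hr0r, ← sub_div,
        div_eq_iff (by have := haq i; positivity)] at hn
      have h1 : ((f i : ℕ) : ℤ) - (g i : ℕ) = n * (2 * a i) := by exact_mod_cast hn
      have h2 : ((2 * (a i).natAbs : ℕ) : ℤ) ∣ ((f i : ℕ) : ℤ) - (g i : ℕ) := by
        rw [h1]
        push_cast
        refine Dvd.dvd.mul_left ?_ n
        rw [← abs_dvd_abs, abs_mul]; simp
      have h3 := (f i).2
      have h4 := (g i).2
      apply Fin.ext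
      have h5 := Int.eq_zero_of_abs_lt_dvd h2 (by rw [abs_lt]; omega)
      omega
  obtain ⟨c1, hc1, h1⟩ := milgram_step hq hL0 hInt hΛ0 hΛ hr0 hr
  choose c hc hg using fun i => gauss_one (a i) (ha i)
  have h2 : ∑ f, ee (q (r0 f)) = (∏ i, (c i : ℂ)) * ee (∑ i, ((a i).sign : ℚ) / 8) := by
    have h3 : ∀ f, ee (q (r0 f)) = ∏ i, ee (a i * ((f i : ℚ) / (2 * a i)) ^ 2) := by
      intro f
      rw [hqb, ee_sum]
      simp only [hr0r]
    simp only [h3]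
    rw [ee_sum, ← Finset.prod_mul_distrib, ← Fintype.piFinset_univ,
      ← Finset.prod_univ_sum (fun i => (Finset.univ : Finset (Fin (2 * (a i).natAbs))))
        (fun i k => ee (a i * ((k : ℚ) / (2 * a i)) ^ 2))]
    exact Finset.prod_congr rfl fun i _ => hg i
  refine ⟨(∏ i, c i) / c1, div_pos (Finset.prod_pos fun i _ => hc i) hc1, ?_⟩
  have : (c1 : ℂ) ≠ 0 := by exact_mod_cast hc1.ne'
  rw [h1] at h2
  push_cast
  field_simp
  rw [mul_comm, h2, mul_comm]

end Cub

open NumberField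
namespace Cub
open Module

section sig
set_option linter.unusedSectionVars false
variable {k : Type*} [Field k] [NumberField k]

lemma trace_mixed (x : k) :
    Algebra.trace ℝ (mixedEmbedding.mixedSpace k) (mixedEmbedding k x) = (Algebra.trace ℚ k x : ℝ) := by
  classical
  rw [Algebra.trace_eq_matrix_trace (mixedEmbedding.latticeBasis k),
    Algebra.trace_eq_matrix_trace (integralBasis k)]
  simp only [Matrix.trace, Matrix.diag, Algebra.leftMulMatrix_eq_repr_mul,
    mixedEmbedding.latticeBasis_apply, ← map_mul, mixedEmbedding.latticeBasis_repr_apply]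
  push_cast
  rfl

/-- the quadratic form `T(β x²)` on the mixed space -/
noncomputable def QF (β : mixedEmbedding.mixedSpace k) :
    QuadraticForm ℝ (mixedEmbedding.mixedSpace k) :=
  LinearMap.BilinMap.toQuadraticMap ((LinearMap.mul ℝ (mixedEmbedding.mixedSpace k)).compr₂
    ((Algebra.trace ℝ (mixedEmbedding.mixedSpace k)).comp (LinearMap.mulLeft ℝ β)))

lemma QF_apply (β x : mixedEmbedding.mixedSpace k) :
    QF β x = Algebra.trace ℝ (mixedEmbedding.mixedSpace k) (β * (x * x)) := rfl

lemma QF_equiv {ι : Type*} [Fintype ι] (β : k) (b : Basis ι ℚ k) (a : ι → ℤ)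
    (hBb : ∀ x y, Algebra.trace ℚ k (2 * β * x * y) =
      ∑ i, 2 * a i * (b.repr x i) * (b.repr y i)) :
    QuadraticMap.Equivalent (QF (mixedEmbedding k β))
      (QuadraticMap.weightedSumSquares ℝ (fun i => (a i : ℝ))) := by
  classical
  have hspan : ⊤ ≤ Submodule.span ℝ (Set.range (fun i => mixedEmbedding k (b i))) := by
    rw [← (mixedEmbedding.latticeBasis k).span_eq, Submodule.span_le]
    rintro _ ⟨j, rfl⟩
    rw [mixedEmbedding.latticeBasis_apply, ← b.sum_repr (integralBasis k j), map_sum]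
    refine Submodule.sum_mem _ fun i _ => ?_
    rw [Algebra.smul_def, map_mul]
    have : mixedEmbedding k (algebraMap ℚ k (b.repr (integralBasis k j) i)) =
        algebraMap ℝ (mixedEmbedding.mixedSpace k) (b.repr (integralBasis k j) i : ℝ) :=
      RingHom.congr_fun (Subsingleton.elim ((mixedEmbedding k).comp (algebraMap ℚ k))
        ((algebraMap ℝ (mixedEmbedding.mixedSpace k)).comp (algebraMap ℚ ℝ))) _
    rw [this, ← Algebra.smul_def]
    exact Submodule.smul_mem _ _ (Submodule.subset_span ⟨i, rfl⟩)
  have hcard : Fintype.card ι = finrank ℝ (mixedEmbedding.mixedSpace k) := by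
    rw [mixedEmbedding.finrank, Module.finrank_eq_card_basis b]
  let b' := basisOfTopLeSpanOfCardEqFinrank _ hspan hcard
  have hb' : ∀ i, b' i = mixedEmbedding k (b i) := fun i => by
    simp [b']
  refine ⟨⟨b'.equivFun, fun x => ?_⟩⟩
  have hB : ∀ i j, Algebra.trace ℝ (mixedEmbedding.mixedSpace k)
      (mixedEmbedding k β * (b' i * b' j)) = if i = j then (a i : ℝ) else 0 := by
    intro i j
    rw [hb', hb', ← map_mul, ← map_mul, trace_mixed]
    have h1 := hBb (b i) (b j)
    rw [show 2 * β * b i * b j = (2 : ℚ) • (β * (b i * b j)) by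
      rw [Algebra.smul_def]; simp; ring, map_smul] at h1
    have h2 : ∑ l, 2 * (a l : ℚ) * (b.repr (b i) l) * (b.repr (b j) l) =
        2 * if i = j then (a i : ℚ) else 0 := by
      simp [Finsupp.single_apply]
      by_cases h : i = j <;> simp [h, eq_comm]
    rw [h2, smul_eq_mul] at h1
    have h3 := mul_left_cancel₀ two_ne_zero h1
    rw [h3]; split_ifs <;> simp
  rw [QF_apply]
  conv_rhs => rw [← b'.sum_equivFun x]
  rw [Finset.sum_mul_sum, Finset.mul_sum]
  have : ∀ i j, Algebra.trace ℝ (mixedEmbedding.mixedSpace k)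
      (mixedEmbedding k β * (b'.equivFun x i • b' i * b'.equivFun x j • b' j)) =
      b'.equivFun x i * b'.equivFun x j * if i = j then (a i : ℝ) else 0 := by
    intro i j
    rw [← hB, smul_mul_smul_comm, mul_smul_comm, map_smul, smul_eq_mul]
  simp only [Finset.mul_sum, map_sum, this]
  simp [QuadraticMap.weightedSumSquares_apply, mul_comm]

lemma exists_sqrt_mixed (γ : k) (hγ : γ ≠ 0) (hpos : ∀ φ : k →+* ℝ, 0 < φ γ) :
    ∃ c : mixedEmbedding.mixedSpace k, IsUnit c ∧ c * c = mixedEmbedding k γ := by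
  have h1 : ∀ w : {w : InfinitePlace k // w.IsComplex}, ∃ z : ℂ, z * z = w.1.embedding γ := by
    intro w
    obtain ⟨z, hz⟩ := IsAlgClosed.exists_pow_nat_eq (w.1.embedding γ) (n := 2) (by norm_num)
    exact ⟨z, by rw [← hz]; ring⟩
  choose z hz using h1
  let c : mixedEmbedding.mixedSpace k :=
    (fun w => Real.sqrt (InfinitePlace.embedding_of_isReal w.2 γ), z)
  have hc : c * c = mixedEmbedding k γ := by
    apply Prod.ext
    · funext w
      simp only [c, Prod.fst_mul, Pi.mul_apply, mixedEmbedding.mixedEmbedding_apply_isReal]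
      exact Real.mul_self_sqrt (hpos _).le
    · funext w
      simp only [c, Prod.snd_mul, Pi.mul_apply, mixedEmbedding.mixedEmbedding_apply_isComplex]
      exact hz w
  refine ⟨c, ?_, hc⟩
  have : IsUnit (c * c) := by
    rw [hc]; exact (IsUnit.mk0 γ hγ).map _
  exact isUnit_of_mul_isUnit_left this

lemma QF_equiv_mul (β c : mixedEmbedding.mixedSpace k) (hc : IsUnit c) :
    QuadraticMap.Equivalent (QF (β * (c * c))) (QF β) := by
  obtain ⟨c, rfl⟩ := hc
  refine ⟨⟨LinearEquiv.ofLinearMap (LinearMap.mulLeft ℝ (c : mixedEmbedding.mixedSpace k))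
    (LinearMap.mulLeft ℝ ((c⁻¹ : (mixedEmbedding.mixedSpace k)ˣ) : mixedEmbedding.mixedSpace k))
    ?_ ?_, fun x => ?_⟩⟩
  · refine LinearMap.ext fun x => ?_
    simp only [LinearMap.comp_apply, LinearMap.mulLeft_apply, Units.mul_inv_cancel_left, LinearMap.id_apply]
  · refine LinearMap.ext fun x => ?_
    simp only [LinearMap.comp_apply, LinearMap.mulLeft_apply, Units.inv_mul_cancel_left, LinearMap.id_apply]
  · change QF β ((c : mixedEmbedding.mixedSpace k) * x) = _
    rw [QF_apply, QF_apply]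
    congr 1; ring

lemma sum_sign_eq {ι : Type*} [Fintype ι] (a a' : ι → ℤ) (ha : ∀ i, a i ≠ 0) (ha' : ∀ i, a' i ≠ 0)
    (h : {i | 0 < (a i : ℝ)}.ncard = {i | 0 < (a' i : ℝ)}.ncard) :
    ∑ i, ((a i).sign : ℚ) = ∑ i, ((a' i).sign : ℚ) := by
  classical
  have key : ∀ a : ι → ℤ, (∀ i, a i ≠ 0) →
      ∑ i, ((a i).sign : ℚ) = 2 * ({i | 0 < (a i : ℝ)}.ncard : ℚ) - Fintype.card ι := by
    intro a ha
    have h1 : ({i | 0 < (a i : ℝ)}.ncard : ℚ) = ∑ i, if 0 < a i then (1 : ℚ) else 0 := by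
      rw [Set.ncard_eq_toFinset_card']
      simp
    have h2 : (Fintype.card ι : ℚ) = ∑ i : ι, (1 : ℚ) := by simp
    rw [h1, h2, Finset.mul_sum, ← Finset.sum_sub_distrib]
    refine Finset.sum_congr rfl fun i _ => ?_
    rcases lt_or_gt_of_ne (ha i) with h | h
    · rw [Int.sign_eq_neg_one_of_neg h, if_neg (by omega)]; norm_num
    · rw [Int.sign_eq_one_of_pos h, if_pos h]; norm_num
  rw [key a ha, key a' ha', h]

lemma sig_eq {ι : Type*} [Fintype ι] (β β' : k) (hβ : β ≠ 0) (hβ' : β' ≠ 0)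
    (hpos : ∀ φ : k →+* ℝ, 0 < φ (β' / β))
    (b b' : Basis ι ℚ k) (a a' : ι → ℤ) (ha : ∀ i, a i ≠ 0) (ha' : ∀ i, a' i ≠ 0)
    (hBb : ∀ x y, Algebra.trace ℚ k (2 * β * x * y) =
      ∑ i, 2 * a i * (b.repr x i) * (b.repr y i))
    (hBb' : ∀ x y, Algebra.trace ℚ k (2 * β' * x * y) =
      ∑ i, 2 * a' i * (b'.repr x i) * (b'.repr y i)) :
    ∑ i, ((a i).sign : ℚ) / 8 = ∑ i, ((a' i).sign : ℚ) / 8 := by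
  obtain ⟨c, hc, hcc⟩ := exists_sqrt_mixed (β' / β) (div_ne_zero hβ' hβ) hpos
  rw [← Finset.sum_div, ← Finset.sum_div]
  congr 1
  apply sum_sign_eq a a' ha ha'
  rw [← QuadraticForm.sigPos_of_equiv_weightedSumSquares (QF_equiv β b a hBb),
    ← QuadraticForm.sigPos_of_equiv_weightedSumSquares (QF_equiv β' b' a' hBb')]
  apply QuadraticMap.Equivalent.sigPos_eq
  have h := QF_equiv_mul (mixedEmbedding k β) c hc
  rw [hcc, ← map_mul, mul_div_cancel₀ _ hβ] at h
  exact h.symm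

end sig
end Cub

open NumberField
namespace Cub
open Module
open scoped nonZeroDivisors

section dd
set_option linter.unusedSectionVars false
variable {k : Type*} [Field k] [NumberField k]

/-- `s` is (one eighth of) the signature of the trace form scaled by `β`. -/
def HasSig (β : k) (s : ℚ) : Prop :=
  ∃ (b : Basis (Fin (finrank ℚ k)) ℚ k) (a : Fin (finrank ℚ k) → ℤ), (∀ i, a i ≠ 0) ∧
    (∀ x y, Algebra.trace ℚ k (2 * β * x * y) =
      ∑ i, 2 * a i * (b.repr x i) * (b.repr y i)) ∧ s = ∑ i, ((a i).sign : ℚ) / 8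

lemma HasSig.unique {β β' : k} {s s' : ℚ} (h : HasSig β s) (h' : HasSig β' s') (hβ : β ≠ 0)
    (hβ' : β' ≠ 0) (hpos : ∀ φ : k →+* ℝ, 0 < φ (β' / β)) : s = s' := by
  obtain ⟨b, a, ha, hb, rfl⟩ := h
  obtain ⟨b', a', ha', hb', rfl⟩ := h'
  exact sig_eq β β' hβ hβ' hpos b b' a a' ha ha' hb hb'

lemma exists_diag (β : k) (hβ : β ≠ 0) (L : AddSubgroup k)
    (hfull : ∀ x : k, ∃ n : ℕ, n ≠ 0 ∧ (n : k) * x ∈ L)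
    (hInt : ∀ x ∈ L, IsI (Algebra.trace ℚ k (β * x * x))) :
    ∃ (b : Basis (Fin (finrank ℚ k)) ℚ k) (a : Fin (finrank ℚ k) → ℤ), (∀ i, a i ≠ 0) ∧
    (∀ x y, Algebra.trace ℚ k (2 * β * x * y) =
      ∑ i, 2 * a i * (b.repr x i) * (b.repr y i)) ∧ ∀ i, b i ∈ L := by
  classical
  let Bf : LinearMap.BilinForm ℚ k := (LinearMap.mul ℚ k).compr₂
    ((Algebra.trace ℚ k).comp (LinearMap.mulLeft ℚ β))
  have hBf : ∀ x y, Bf x y = Algebra.trace ℚ k (β * (x * y)) := fun x y => rfl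
  have hinv : Invertible (2 : ℚ) := invertibleOfNonzero two_ne_zero
  obtain ⟨v, hv⟩ := LinearMap.BilinForm.exists_orthogonal_basis (B := Bf)
    ⟨fun x y => by simp only [hBf, mul_comm, RingHom.id_apply]⟩
  choose n hn hnL using fun i => hfull (v i)
  let b := v.unitsSMul (fun i => Units.mk0 (n i : ℚ) (by exact_mod_cast hn i))
  have hb : ∀ i, b i = (n i : k) * v i := by
    intro i
    simp [b, Basis.unitsSMul_apply, Units.smul_def, Algebra.smul_def]
  have hbL : ∀ i, b i ∈ L := fun i => by rw [hb]; exact hnL i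
  choose a ha using fun i => hInt (b i) (hbL i)
  have hB : ∀ i j, Bf (b i) (b j) = if i = j then (a i : ℚ) else 0 := by
    intro i j
    split_ifs with h
    · subst h
      rw [hBf, ← ha, mul_assoc]
    · have h1 : Bf (v i) (v j) = 0 := hv h
      rw [hBf] at h1
      rw [hBf, hb, hb, show β * ((n i : k) * v i * ((n j : k) * v j)) =
        ((n i : ℚ) * n j) • (β * (v i * v j)) by rw [Algebra.smul_def]; simp; ring, map_smul, h1,
        smul_zero]
  have hBxy : ∀ x y, Bf x y = ∑ i, a i * (b.repr x i) * (b.repr y i) := by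
    intro x y
    conv_lhs => rw [← b.sum_repr x, ← b.sum_repr y]
    simp only [map_sum, LinearMap.sum_apply, map_smul, LinearMap.smul_apply, hB]
    simp only [smul_eq_mul, mul_ite, mul_zero, Finset.sum_ite_eq', Finset.sum_ite_eq,
      Finset.mem_univ, if_true]
    exact Finset.sum_congr rfl fun i _ => by ring
  refine ⟨b, a, fun i hi => ?_, fun x y => ?_, hbL⟩
  · have h1 : Bf (b i) (β * b i)⁻¹ = 0 := by
      rw [hBxy]
      refine Finset.sum_eq_zero fun j _ => ?_
      by_cases hij : i = j
      · subst hij; simp [hi]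
      · simp [Finsupp.single_apply, hij]
    rw [hBf, ← mul_assoc, mul_inv_cancel₀ (mul_ne_zero hβ (b.ne_zero i))] at h1
    have h2 := Algebra.trace_algebraMap (R := ℚ) (S := k) 1
    rw [map_one, h1] at h2
    have := finrank_pos (R := ℚ) (M := k)
    rw [nsmul_eq_mul, mul_one] at h2
    have h3 : (finrank ℚ k : ℚ) ≠ 0 := by exact_mod_cast this.ne'
    exact h3 h2.symm
  · rw [show 2 * β * x * y = (2 : ℚ) • (β * (x * y)) by rw [Algebra.smul_def]; simp; ring, map_smul]
    change (2 : ℚ) • Bf x y = _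
    rw [hBxy, smul_eq_mul, Finset.mul_sum]
    exact Finset.sum_congr rfl fun i _ => by ring

variable (k) in
/-- fractional ideals of `k` -/
abbrev FI := FractionalIdeal (𝓞 k)⁰ k

/-- underlying group of a fractional ideal -/
def lat (I : FI k) : AddSubgroup k := (I : Submodule (𝓞 k) k).toAddSubgroup

@[simp] lemma mem_lat {I : FI k} {x : k} : x ∈ lat I ↔ x ∈ I := Iff.rfl

lemma lat_mono {I J : FI k} (h : I ≤ J) : lat I ≤ lat J := fun _ hx => h hx

variable (k) in
/-- inverse different -/
noncomputable def Dv : FI k := FractionalIdeal.dual ℤ ℚ (1 : FI k)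

lemma Dv_ne_zero : Dv k ≠ 0 := FractionalIdeal.dual_ne_zero ℤ ℚ one_ne_zero

lemma isI_iff (x : ℚ) : IsI x ↔ x ∈ (algebraMap ℤ ℚ).range := by
  constructor
  · rintro ⟨n, rfl⟩; exact ⟨n, rfl⟩
  · rintro ⟨n, rfl⟩; exact ⟨n, rfl⟩

lemma mem_dual' {I : FI k} (hI : I ≠ 0) (x : k) :
    x ∈ Dv k * I⁻¹ ↔ ∀ y ∈ I, IsI (Algebra.trace ℚ k (x * y)) := by
  rw [Dv, ← FractionalIdeal.dual_eq_mul_inv, FractionalIdeal.mem_dual hI]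
  simp only [isI_iff, Algebra.traceForm_apply]

lemma mem_Dv (x : k) : x ∈ Dv k ↔ ∀ y : 𝓞 k, IsI (Algebra.trace ℚ k (x * y)) := by
  have := mem_dual' (I := (1 : FI k)) one_ne_zero x
  rw [inv_one, mul_one] at this
  rw [this]
  constructor
  · intro h y; exact h y (FractionalIdeal.mem_one_iff _ |>.2 ⟨y, rfl⟩)
  · intro h y hy
    obtain ⟨z, rfl⟩ := (FractionalIdeal.mem_one_iff _).1 hy
    exact h z

lemma isI_of_mem_Dv {x : k} (h : x ∈ Dv k) : IsI (Algebra.trace ℚ k x) := by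
  simpa using (mem_Dv x).1 h 1

lemma FI_full {I : FI k} (hI : I ≠ 0) (x : k) : ∃ n : ℕ, n ≠ 0 ∧ (n : k) * x ∈ I := by
  obtain ⟨y, hy, hyI⟩ : ∃ y : k, y ≠ 0 ∧ y ∈ I := by
    by_contra! h
    exact hI (FractionalIdeal.eq_zero_iff.2 fun y hy => by
      by_contra h'; exact h y h' hy)
  obtain ⟨m, hm, hmi⟩ := (IsFractionRing.comap_isAlgebraic_iff (A := ℤ) (K := ℚ) (C := k)).2
    inferInstance |>.isAlgebraic (x / y) |>.exists_integral_multiple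
  refine ⟨m.natAbs, by simpa using hm, ?_⟩
  have h1 : (m : k) * x ∈ I := by
    have h2 := (I : Submodule (𝓞 k) k).smul_mem (⟨m • (x / y), hmi⟩ : 𝓞 k) hyI
    have h3 : (⟨m • (x / y), hmi⟩ : 𝓞 k) • y = (m : k) * x := by
      rw [Algebra.smul_def]
      change (m • (x / y)) * y = _
      rw [zsmul_eq_mul]; field_simp
    exact h3 ▸ h2
  rcases Int.natAbs_eq m with h | h
  · rw [h] at h1; simpa using h1
  · rw [h] at h1
    have := (I : Submodule (𝓞 k) k).neg_mem h1
    simpa using this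

lemma relIndex_lat {I J : FI k} (hI : I ≠ 0) : (lat I).relIndex (lat J) ≠ 0 := by
  have h1 : AddGroup.FG (lat J) := Module.Finite.iff_addGroup_fg.1
    (inferInstanceAs (Module.Finite ℤ J))
  have h2 : Finite (lat J ⧸ (lat I).addSubgroupOf (lat J)) := by
    refine AddCommGroup.finite_of_fg_isAddTorsion _ (fun x => ?_)
    obtain ⟨x, rfl⟩ := QuotientAddGroup.mk_surjective x
    obtain ⟨n, hn, hx⟩ := FI_full hI (x : k)
    rw [isOfFinAddOrder_iff_nsmul_eq_zero]
    refine ⟨n, Nat.pos_of_ne_zero hn, ?_⟩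
    rw [← QuotientAddGroup.mk_nsmul, QuotientAddGroup.eq_zero_iff, AddSubgroup.mem_addSubgroupOf]
    simpa using hx
  exact AddSubgroup.index_ne_zero_of_finite

lemma exists_trv {I J : FI k} (hI : I ≠ 0) : ∃ (n : ℕ) (r : Fin n → k), IsTrv (lat J) (lat I) r :=
  IsTrv.exists_of_finite _ _ (relIndex_lat hI)

lemma qdata (β : k) : QData (fun x : k => Algebra.trace ℚ k (β * x * x))
    (fun x y => Algebra.trace ℚ k (2 * β * x * y)) := by
  refine ⟨fun x y => ?_, fun x y z => ?_, fun x y z => ?_⟩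
  · rw [← map_add, ← map_add]; congr 1; ring
  · rw [← map_add]; congr 1; ring
  · rw [← map_add]; congr 1; ring

/-- Milgram's formula for fractional ideals -/
lemma milgramFI (β : k) (hβ : β ≠ 0) (I t : FI k) (hI : I ≠ 0) (ht : t ≠ 0) (ht1 : t ≤ 1)
    (h : FractionalIdeal.spanSingleton _ β * I ^ 2 = t * Dv k) {κ : Type*} [Fintype κ] {r : κ → k}
    (hr : IsTrv (lat (I * (FractionalIdeal.spanSingleton _ 2 * t)⁻¹)) (lat I) r) :
    ∃ (s : ℚ) (c : ℝ), HasSig β s ∧ 0 < c ∧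
      ∑ i, ee (Algebra.trace ℚ k (β * r i * r i)) = c * ee s := by
  have hInt : ∀ x ∈ lat I, IsI (Algebra.trace ℚ k (β * x * x)) := by
    intro x hx
    apply isI_of_mem_Dv
    have h1 : β * (x * x) ∈ FractionalIdeal.spanSingleton (𝓞 k)⁰ β * I ^ 2 := by
      rw [sq]
      exact FractionalIdeal.mul_mem_mul (FractionalIdeal.mem_spanSingleton_self _ _)
        (FractionalIdeal.mul_mem_mul hx hx)
    rw [h] at h1
    rw [mul_assoc]
    have h2 : t * Dv k ≤ 1 * Dv k := by gcongr
    rw [one_mul] at h2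
    exact h2 h1
  obtain ⟨b, a, ha, hB, hb⟩ := exists_diag β hβ (lat I) (FI_full hI) hInt
  have hsp : FractionalIdeal.spanSingleton (𝓞 k)⁰ β ≠ 0 := FractionalIdeal.spanSingleton_ne_zero_iff.2 hβ
  have hsp2 : FractionalIdeal.spanSingleton (𝓞 k)⁰ (2 : k) ≠ 0 :=
    FractionalIdeal.spanSingleton_ne_zero_iff.2 two_ne_zero
  have hkey : I * (FractionalIdeal.spanSingleton _ 2 * t)⁻¹ =
      FractionalIdeal.spanSingleton _ ((2 * β)⁻¹) * (Dv k * I⁻¹) := by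
    have : Dv k = t⁻¹ * (FractionalIdeal.spanSingleton _ β * I ^ 2) := by
      rw [h, inv_mul_cancel_left₀ ht]
    rw [this, ← FractionalIdeal.spanSingleton_inv, ← FractionalIdeal.spanSingleton_mul_spanSingleton]
    field_simp
  have hΛ : ∀ x, x ∈ lat (I * (FractionalIdeal.spanSingleton _ 2 * t)⁻¹) ↔
      ∀ y ∈ lat I, IsI (Algebra.trace ℚ k (2 * β * x * y)) := by
    intro x
    rw [mem_lat, hkey, FractionalIdeal.mem_singleton_mul]
    have h2 : (2 * β) ≠ 0 := mul_ne_zero two_ne_zero hβ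
    constructor
    · rintro ⟨y, hy, rfl⟩
      rw [mul_inv_cancel_left₀ h2]
      exact (mem_dual' hI y).1 hy
    · intro hx
      exact ⟨2 * β * x, (mem_dual' hI _).2 hx, by field_simp⟩
  obtain ⟨c, hc, h1⟩ := milgram (qdata β) b a ha (fun x => by
    have := hB x x
    rw [show 2 * β * x * x = (2 : ℚ) • (β * x * x) by rw [Algebra.smul_def]; simp; ring,
      map_smul, smul_eq_mul] at this
    have h2 : ∑ i, 2 * (a i : ℚ) * (b.repr x) i * (b.repr x) i =
      2 * ∑ i, (a i : ℚ) * (b.repr x i) ^ 2 := by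
      rw [Finset.mul_sum]; exact Finset.sum_congr rfl fun i _ => by ring
    rw [h2] at this
    exact mul_left_cancel₀ two_ne_zero this) hB hb hInt hΛ hr
  exact ⟨_, c, ⟨b, a, ha, hB, rfl⟩, hc, h1⟩

end dd
end Cub

open NumberField
namespace Cub
open Module
open scoped nonZeroDivisors

section dd
set_option linter.unusedSectionVars false
set_option linter.style.haveILetI false
variable {k : Type*} [Field k] [NumberField k]

lemma co_sub (a b : 𝓞 k) : ((a - b : 𝓞 k) : k) = (a : k) - b := map_sub (algebraMap (𝓞 k) k) a b
lemma co_add (a b : 𝓞 k) : ((a + b : 𝓞 k) : k) = (a : k) + b := map_add (algebraMap (𝓞 k) k) a b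
lemma co_mul (a b : 𝓞 k) : ((a * b : 𝓞 k) : k) = (a : k) * b := map_mul (algebraMap (𝓞 k) k) a b
lemma co_pow (a : 𝓞 k) (n : ℕ) : ((a ^ n : 𝓞 k) : k) = (a : k) ^ n :=
  map_pow (algebraMap (𝓞 k) k) a n
lemma co_two : ((2 : 𝓞 k) : k) = 2 := map_ofNat (algebraMap (𝓞 k) k) 2
lemma co_one : ((1 : 𝓞 k) : k) = 1 := map_one (algebraMap (𝓞 k) k)



variable (k) in
/-- finite primes of `k` -/
abbrev PP := IsDedekindDomain.HeightOneSpectrum (𝓞 k)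

lemma finite_quot (v : PP k) : Finite (𝓞 k ⧸ v.asIdeal) := Ideal.finiteQuotientOfFreeOfNeBot _ v.ne_bot

open Classical in
/-- quadratic residue symbol -/
noncomputable def chi (v : PP k) (u : 𝓞 k) : ℤ :=
  letI := Ideal.Quotient.field v.asIdeal
  letI := finite_quot v
  letI := Fintype.ofFinite (𝓞 k ⧸ v.asIdeal)
  quadraticChar (𝓞 k ⧸ v.asIdeal) (Ideal.Quotient.mk _ u)

lemma chi_mul (v : PP k) (a b : 𝓞 k) : chi v (a * b) = chi v a * chi v b := by
  simp only [chi, map_mul]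

lemma chi_dichotomy (v : PP k) (a : 𝓞 k) (h : a ∉ v.asIdeal) : chi v a = 1 ∨ chi v a = -1 := by
  classical
  letI := Ideal.Quotient.field v.asIdeal
  letI := finite_quot v
  letI := Fintype.ofFinite (𝓞 k ⧸ v.asIdeal)
  exact quadraticChar_dichotomy (by rwa [Ne, Ideal.Quotient.eq_zero_iff_mem])

lemma chi_sq (v : PP k) (a : 𝓞 k) (h : a ∉ v.asIdeal) : chi v (a * a) = 1 := by
  rw [chi_mul]
  rcases chi_dichotomy v a h with h | h <;> rw [h] <;> norm_num

lemma ringChar_ne_two (v : PP k) (h2 : (2 : 𝓞 k) ∉ v.asIdeal) : ringChar (𝓞 k ⧸ v.asIdeal) ≠ 2 := by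
  intro h
  have h1 := ringChar.Nat.cast_ringChar (R := 𝓞 k ⧸ v.asIdeal)
  rw [h] at h1
  apply h2
  rw [← Ideal.Quotient.eq_zero_iff_mem, map_ofNat]
  simpa using h1

lemma chi_neg_one (v : PP k) (a : 𝓞 k) (h2 : (2 : 𝓞 k) ∉ v.asIdeal)
    (h : ∀ b : 𝓞 k, a - b * b ∉ v.asIdeal) : chi v a = -1 := by
  classical
  letI := Ideal.Quotient.field v.asIdeal
  letI := finite_quot v
  letI := Fintype.ofFinite (𝓞 k ⧸ v.asIdeal)
  refine (quadraticChar_neg_one_iff_not_isSquare).2 ?_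
  rintro ⟨b, hb⟩
  obtain ⟨b, rfl⟩ := Ideal.Quotient.mk_surjective b
  apply h b
  rw [← Ideal.Quotient.eq_zero_iff_mem, map_sub, map_mul, hb, sub_self]

lemma gaussF {F : Type*} [Field F] [Fintype F] [DecidableEq F] (hF : ringChar F ≠ 2)
    (ψ : AddChar F ℂ) (hψ : ψ ≠ 1) (u : F) (hu : u ≠ 0) :
    ∑ c, ψ (u * c ^ 2) = quadraticChar F u * ∑ c, ψ (c ^ 2) := by
  have key : ∀ u : F, u ≠ 0 → ∑ c, ψ (u * c ^ 2) = quadraticChar F u * ∑ d, quadraticChar F d * ψ d := by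
    intro u hu
    have h0 : ∑ d, ψ d = 0 := AddChar.sum_eq_zero_of_ne_one hψ
    have h1 : ∑ d, ψ (u * d) = 0 := by
      rw [← h0]
      exact Fintype.sum_bijective (fun d => u * d) (mulLeft_bijective₀ u hu) _ _ fun _ => rfl
    have h2 : ∑ c, ψ (u * c ^ 2) = ∑ d, ∑ c ∈ Finset.univ.filter (fun c : F => c ^ 2 = d), ψ (u * d) := by
      rw [← Finset.sum_fiberwise (s := Finset.univ) (g := fun c : F => c ^ 2)]
      refine Finset.sum_congr rfl fun d _ => Finset.sum_congr rfl fun c hc => ?_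
      rw [(Finset.mem_filter.1 hc).2]
    have h3 : ∀ d : F, ∑ c ∈ Finset.univ.filter (fun c : F => c ^ 2 = d), ψ (u * d) =
        quadraticChar F d * ψ (u * d) + ψ (u * d) := by
      intro d
      rw [Finset.sum_const, nsmul_eq_mul]
      have := quadraticChar_card_sqrts hF d
      have h4 : ((Finset.univ.filter (fun c : F => c ^ 2 = d)).card : ℤ) = quadraticChar F d + 1 := by
        rw [← this]; congr 2; ext; simp
      have h5 : ((Finset.univ.filter (fun c : F => c ^ 2 = d)).card : ℂ) = (quadraticChar F d : ℂ) + 1 := by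
        exact_mod_cast h4
      rw [h5]; ring
    rw [h2]
    simp only [h3]
    rw [Finset.sum_add_distrib, h1, add_zero, Finset.mul_sum]
    refine Fintype.sum_bijective (fun d => u * d) (mulLeft_bijective₀ u hu) _ _ fun d => ?_
    rw [map_mul (quadraticChar F)]
    have := quadraticChar_sq_one hu
    have h6 : (quadraticChar F u : ℂ) ^ 2 = 1 := by exact_mod_cast this
    push_cast
    linear_combination (-(quadraticChar F d : ℂ) * ψ (u * d)) * h6
  rw [key u hu]
  have := key 1 one_ne_zero
  simp only [one_mul, map_one, Int.cast_one] at this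
  rw [this]

open FractionalIdeal in
lemma ppart (β : k) (I : FI k) (hI : I ≠ 0) (t : Ideal (𝓞 k))
    (h : spanSingleton _ β * I ^ 2 = (t : FI k) * Dv k) (v : PP k) (h2 : (2 : 𝓞 k) ∉ v.asIdeal)
    (hvt : v.asIdeal ∣ t) (hvt2 : ¬ v.asIdeal ^ 2 ∣ t) {κ : Type*} [Fintype κ] {r : κ → k}
    (hr : IsTrv (lat (I * (v.asIdeal : FI k)⁻¹)) (lat I) r) (u : 𝓞 k) (hu : u ∉ v.asIdeal) :
    ∑ i, ee (Algebra.trace ℚ k (u * β * r i * r i)) =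
      chi v u * ∑ i, ee (Algebra.trace ℚ k (β * r i * r i)) := by
  classical
  letI := Ideal.Quotient.field v.asIdeal
  letI := finite_quot v
  letI := Fintype.ofFinite (𝓞 k ⧸ v.asIdeal)
  have hv0 : (v.asIdeal : FI k) ≠ 0 := coeIdeal_ne_zero.2 v.ne_bot
  have ht0 : t ≠ 0 := by rintro rfl; exact hvt2 (dvd_zero _)
  have ht0' : (t : FI k) ≠ 0 := coeIdeal_ne_zero.2 ht0
  -- basic integrality
  have hDv : spanSingleton _ β * (I * (v.asIdeal : FI k)⁻¹) * I ≤ Dv k := by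
    obtain ⟨t', rfl⟩ := hvt
    have : spanSingleton _ β * (I * (v.asIdeal : FI k)⁻¹) * I = (t' : FI k) * Dv k := by
      rw [coeIdeal_mul, mul_assoc] at h
      calc _ = (v.asIdeal : FI k)⁻¹ * (spanSingleton _ β * I ^ 2) := by ring
        _ = _ := by rw [h, inv_mul_cancel_left₀ hv0]
    rw [this]
    calc (t' : FI k) * Dv k ≤ 1 * Dv k := by gcongr; exact coeIdeal_le_one
      _ = _ := one_mul _
  have hmul : ∀ d ∈ v.asIdeal, ∀ x ∈ I * (v.asIdeal : FI k)⁻¹, (d : k) * x ∈ I := by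
    intro d hd x hx
    have h1 : (d : k) * x ∈ (v.asIdeal : FI k) * (I * (v.asIdeal : FI k)⁻¹) :=
      mul_mem_mul ((mem_coeIdeal _).2 ⟨d, hd, rfl⟩) hx
    rwa [mul_comm I, mul_inv_cancel_left₀ hv0] at h1
  have hsm : ∀ (J : FI k) (d : 𝓞 k) (x : k), x ∈ J → (d : k) * x ∈ J := by
    intro J d x hx
    have := (J : Submodule (𝓞 k) k).smul_mem d hx
    rwa [Algebra.smul_def] at this
  have hle : I ≤ I * (v.asIdeal : FI k)⁻¹ := by
    calc I = I * ((v.asIdeal : FI k) * (v.asIdeal : FI k)⁻¹) := by rw [mul_inv_cancel₀ hv0, mul_one]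
      _ ≤ I * (1 * (v.asIdeal : FI k)⁻¹) := by gcongr; exact coeIdeal_le_one
      _ = _ := by rw [one_mul]
  have hne : ¬ I * (v.asIdeal : FI k)⁻¹ ≤ I := by
    intro hle'
    have h1 : I * (v.asIdeal : FI k)⁻¹ = I * 1 := by rw [mul_one]; exact le_antisymm hle' hle
    have h2 := mul_left_cancel₀ hI h1
    rw [inv_eq_one, ] at h2
    rw [coeIdeal_eq_one] at h2
    exact v.isPrime.ne_top (by simpa using h2)
  obtain ⟨x0, hx0, hx0I⟩ := SetLike.not_le_iff_exists.1 hne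
  have hsum : I ⊔ spanSingleton _ x0 = I * (v.asIdeal : FI k)⁻¹ := by
    set J := I ⊔ spanSingleton _ x0 with hJ
    have hJle : J ≤ I * (v.asIdeal : FI k)⁻¹ := sup_le hle (by
      rw [spanSingleton_le_iff_mem]; exact hx0)
    have h1 : J * (I⁻¹ * v.asIdeal) ≤ 1 := by
      calc _ ≤ (I * (v.asIdeal : FI k)⁻¹) * (I⁻¹ * v.asIdeal) := by gcongr
        _ = 1 := by field_simp
    obtain ⟨j, hj⟩ := le_one_iff_exists_coeIdeal.1 h1
    have h3 : v.asIdeal ≤ j := by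
      rw [← coeIdeal_le_coeIdeal k, hj]
      calc (v.asIdeal : FI k) = I * (I⁻¹ * v.asIdeal) := by field_simp
        _ ≤ _ := by gcongr; exact le_sup_left
    have hJe : J = (j : FI k) * (I * (v.asIdeal : FI k)⁻¹) := by
      rw [hj]; field_simp
    have h4 : j = ⊤ := by
      rcases (v.isMaximal.out.le_iff.1 h3) with h4 | h4
      · exact h4
      · exfalso
        apply hx0I
        rw [h4, mul_comm I, mul_inv_cancel_left₀ hv0] at hJe
        rw [← hJe]
        exact (le_sup_right : _ ≤ J) (mem_spanSingleton_self _ _)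
    rw [hJe, h4, coeIdeal_top, one_mul]
  let w : (𝓞 k ⧸ v.asIdeal) → 𝓞 k := Function.surjInv Ideal.Quotient.mk_surjective
  have hw : ∀ c, Ideal.Quotient.mk _ (w c) = c := Function.surjInv_eq Ideal.Quotient.mk_surjective
  have hs : IsTrv (lat (I * (v.asIdeal : FI k)⁻¹)) (lat I) (fun c => (w c : k) * x0) := by
    refine ⟨fun c => hsm _ _ _ hx0, fun x hx => ?_, fun c d hcd => ?_⟩
    · rw [mem_lat, ← hsum, ← mem_coe, coe_sup, Submodule.mem_sup] at hx
      obtain ⟨y, hy, z, hz, rfl⟩ := hx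
      obtain ⟨a, rfl⟩ := (mem_spanSingleton _).1 hz
      refine ⟨Ideal.Quotient.mk _ a, ?_⟩
      have h3 : a - w (Ideal.Quotient.mk _ a) ∈ v.asIdeal := by
        rw [← Ideal.Quotient.eq_zero_iff_mem, map_sub, hw, sub_self]
      have h4 := hmul _ h3 _ hx0
      rw [Algebra.smul_def]
      have h5 := (I : Submodule (𝓞 k) k).add_mem hy h4
      rw [mem_lat, show y + algebraMap (𝓞 k) k a * x0 - (w (Ideal.Quotient.mk _ a) : k) * x0 =
        y + ((a - w (Ideal.Quotient.mk _ a) : 𝓞 k) : k) * x0 by rw [co_sub]; ring]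
      exact h5
    · by_contra hne'
      have h3 : w c - w d ∉ v.asIdeal := by
        rw [← Ideal.Quotient.eq_zero_iff_mem, map_sub, hw, hw]
        exact sub_ne_zero.2 hne'
      obtain ⟨e, he⟩ := Ideal.IsMaximal.exists_inv v.isMaximal h3
      obtain ⟨i, hi, hei⟩ := he
      have h4 := hsm I e _ hcd
      have h5 := hmul _ hi _ hx0
      apply hx0I
      have h6 := (I : Submodule (𝓞 k) k).add_mem h4 h5
      have h7 := congrArg (algebraMap (𝓞 k) k) hei
      simp only [map_add, map_mul, map_sub, map_one] at h7
      have h8 : x0 = (e : k) * ((w c : k) * x0 - (w d : k) * x0) + (i : k) * x0 := by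
        linear_combination (-x0) * h7
      rw [h8]
      exact h6
  have hper : ∀ a : 𝓞 k, ∀ x ∈ lat (I * (v.asIdeal : FI k)⁻¹), ∀ l ∈ lat I,
      ee (Algebra.trace ℚ k (a * β * (x + l) * (x + l))) = ee (Algebra.trace ℚ k (a * β * x * x)) := by
    intro a x hx l hl
    rw [show (a : k) * β * (x + l) * (x + l) = a * β * x * x + a * (2 * (β * x * l) + β * l * l) by
      ring, map_add, ee_add_isI]
    apply isI_of_mem_Dv
    apply hsm
    have h3 : β * x * l ∈ Dv k := hDv (mul_mem_mul (mul_mem_mul (mem_spanSingleton_self _ _) hx) hl)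
    have h4 : β * l * l ∈ Dv k :=
      hDv (mul_mem_mul (mul_mem_mul (mem_spanSingleton_self _ _) (hle hl)) hl)
    refine (Dv k : Submodule (𝓞 k) k).add_mem ?_ h4
    have := hsm _ 2 _ h3
    rwa [co_two] at this
  have e1 := hr.sum_eq hs (fun x => ee (Algebra.trace ℚ k (u * β * x * x))) (hper u)
  have e2 := hr.sum_eq hs (fun x => ee (Algebra.trace ℚ k (((1 : 𝓞 k) : k) * β * x * x))) (hper 1)
  simp only [co_one, one_mul] at e2
  rw [e1, e2]
  let ψ0 : (𝓞 k ⧸ v.asIdeal) → ℂ := fun c => ee (Algebra.trace ℚ k (β * x0 * x0 * w c))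
  have hψ0 : ∀ a, ψ0 (Ideal.Quotient.mk _ a) = ee (Algebra.trace ℚ k (β * x0 * x0 * a)) := by
    intro a
    have h3 : a - w (Ideal.Quotient.mk _ a) ∈ v.asIdeal := by
      rw [← Ideal.Quotient.eq_zero_iff_mem, map_sub, hw, sub_self]
    have h4 := hmul _ h3 _ hx0
    have h5 : β * x0 * (((a - w (Ideal.Quotient.mk _ a) : 𝓞 k) : k) * x0) ∈ Dv k :=
      hDv (mul_mem_mul (mul_mem_mul (mem_spanSingleton_self _ _) hx0) h4)
    rw [show β * x0 * x0 * (a : k) = β * x0 * x0 * (w (Ideal.Quotient.mk _ a) : k) +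
      β * x0 * (((a - w (Ideal.Quotient.mk _ a) : 𝓞 k) : k) * x0) by rw [co_sub]; ring,
      map_add, ee_add_isI _ (isI_of_mem_Dv h5)]
  let ψ : AddChar (𝓞 k ⧸ v.asIdeal) ℂ :=
    { toFun := ψ0
      map_zero_eq_one' := by
        have := hψ0 0
        rw [map_zero] at this
        rw [this]; simp [ee_zero]
      map_add_eq_mul' := by
        intro a b
        obtain ⟨a, rfl⟩ := Ideal.Quotient.mk_surjective a
        obtain ⟨b, rfl⟩ := Ideal.Quotient.mk_surjective b
        rw [← map_add, hψ0, hψ0, hψ0, ← ee_add, ← map_add, co_add, mul_add] }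
  have hψ : ∀ a, ψ (Ideal.Quotient.mk _ a) = ee (Algebra.trace ℚ k (β * x0 * x0 * a)) := hψ0
  have hψ1 : ψ ≠ 1 := by
    intro h1
    have h3 : β * x0 * x0 ∈ Dv k := by
      rw [mem_Dv]
      intro y
      apply ee_eq_one
      rw [← hψ, h1, AddChar.one_apply]
    have h4 : spanSingleton _ β * (I * (v.asIdeal : FI k)⁻¹) * (I * (v.asIdeal : FI k)⁻¹) ≤ Dv k := by
      nth_rewrite 2 [← hsum]
      rw [sup_eq_add, mul_add, ← sup_eq_add]
      refine sup_le hDv ?_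
      rw [← hsum, sup_eq_add, mul_add, add_mul, ← sup_eq_add]
      refine sup_le ?_ ?_
      · calc spanSingleton (𝓞 k)⁰ β * I * spanSingleton _ x0 ≤
            spanSingleton (𝓞 k)⁰ β * I * (I * (v.asIdeal : FI k)⁻¹) := by
              gcongr; rw [spanSingleton_le_iff_mem]; exact hx0
          _ = spanSingleton _ β * (I * (v.asIdeal : FI k)⁻¹) * I := by ring
          _ ≤ _ := hDv
      · rw [spanSingleton_mul_spanSingleton, spanSingleton_mul_spanSingleton,
          spanSingleton_le_iff_mem]
        exact h3
    apply hvt2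
    rw [Ideal.dvd_iff_le, ← coeIdeal_le_coeIdeal k, coeIdeal_pow]
    have h5 : spanSingleton _ β * (I * (v.asIdeal : FI k)⁻¹) * (I * (v.asIdeal : FI k)⁻¹) =
        ((v.asIdeal : FI k)⁻¹) ^ 2 * (t : FI k) * Dv k := by
      rw [mul_assoc _ (t : FI k), ← h]; ring
    rw [h5] at h4
    have hD := Dv_ne_zero (k := k)
    calc (t : FI k) = (((v.asIdeal : FI k)⁻¹) ^ 2 * (t : FI k) * Dv k) * ((v.asIdeal : FI k) ^ 2 * (Dv k)⁻¹) := by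
          field_simp
      _ ≤ Dv k * ((v.asIdeal : FI k) ^ 2 * (Dv k)⁻¹) := by gcongr
      _ = _ := by field_simp
  have hg := gaussF (ringChar_ne_two v h2) ψ hψ1 (Ideal.Quotient.mk _ u)
    (by rwa [Ne, Ideal.Quotient.eq_zero_iff_mem])
  have f1 : ∀ c, ψ (Ideal.Quotient.mk _ u * c ^ 2) =
      ee (Algebra.trace ℚ k (u * β * ((w c : k) * x0) * ((w c : k) * x0))) := by
    intro c
    have : Ideal.Quotient.mk _ u * c ^ 2 = Ideal.Quotient.mk _ (u * w c ^ 2) := by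
      rw [map_mul, map_pow, hw]
    rw [this, hψ]
    congr 2
    rw [co_mul, co_pow]; ring
  have f2 : ∀ c, ψ (c ^ 2) =
      ee (Algebra.trace ℚ k (β * ((w c : k) * x0) * ((w c : k) * x0))) := by
    intro c
    have : c ^ 2 = Ideal.Quotient.mk _ (w c ^ 2) := by
      rw [map_pow, hw]
    rw [this, hψ]
    congr 2
    rw [co_pow]; ring
  simp only [f1, f2] at hg
  exact hg

end dd
end Cub

open NumberField
namespace Cub
open Module
open scoped nonZeroDivisors

section dd
set_option linter.unusedSectionVars false
variable {k : Type*} [Field k] [NumberField k]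
open FractionalIdeal

lemma FI_smul (J : FI k) (a : 𝓞 k) (x : k) (hx : x ∈ J) : (a : k) * x ∈ J := by
  have := (J : Submodule (𝓞 k) k).smul_mem a hx
  rwa [Algebra.smul_def] at this

lemma le_mul_inv (I : FI k) (a : Ideal (𝓞 k)) (ha : a ≠ ⊥) : I ≤ I * (a : FI k)⁻¹ := by
  have hv0 : (a : FI k) ≠ 0 := coeIdeal_ne_zero.2 ha
  calc I = I * ((a : FI k) * (a : FI k)⁻¹) := by rw [mul_inv_cancel₀ hv0, mul_one]
      _ ≤ I * (1 * (a : FI k)⁻¹) := by gcongr; exact coeIdeal_le_one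
      _ = _ := by rw [one_mul]

lemma mul_mem_of_inv (I : FI k) (a : Ideal (𝓞 k)) (ha : a ≠ ⊥) (x : k) (hx : x ∈ I * (a : FI k)⁻¹)
    (α : 𝓞 k) (hα : α ∈ a) : (α : k) * x ∈ I := by
  have hv0 : (a : FI k) ≠ 0 := coeIdeal_ne_zero.2 ha
  have h1 : (α : k) * x ∈ (a : FI k) * (I * (a : FI k)⁻¹) :=
    mul_mem_mul (mem_coeIdeal_of_mem _ hα) hx
  rwa [show (a : FI k) * (I * (a : FI k)⁻¹) = I by field_simp] at h1

lemma coprime_trv (I : FI k) (a b : Ideal (𝓞 k)) (ha : a ≠ ⊥) (hb : b ≠ ⊥) (hab : a ⊔ b = ⊤)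
    {κ : Type*} {r : κ → k} (hr : IsTrv (lat (I * (a : FI k)⁻¹)) (lat I) r) :
    IsTrv (lat (I * (a : FI k)⁻¹ * (b : FI k)⁻¹)) (lat (I * (b : FI k)⁻¹)) r := by
  obtain ⟨α, hα, γ, hγ, h1⟩ := Submodule.mem_sup.1 ((Ideal.eq_top_iff_one _).1 hab)
  have h1' : (α : k) + γ = 1 := by rw [← co_add, h1, co_one]
  refine ⟨fun i => le_mul_inv _ b hb (hr.mem i), fun x hx => ?_, fun i j hij => ?_⟩
  · have hx' : x ∈ I * (b : FI k)⁻¹ * (a : FI k)⁻¹ := by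
      rw [mul_right_comm]; exact hx
    have h2 := mul_mem_of_inv _ b hb x hx γ hγ
    have h3 := mul_mem_of_inv _ a ha x hx' α hα
    obtain ⟨i, hi⟩ := hr.ex _ h2
    refine ⟨i, ?_⟩
    have h4 := (lat (I * (b : FI k)⁻¹)).add_mem h3 (le_mul_inv _ b hb hi)
    have : (α : k) * x + (γ * x - r i) = x - r i := by linear_combination x * h1'
    rwa [this] at h4
  · apply hr.inj
    have h2 := mul_mem_of_inv _ b hb _ hij γ hγ
    have h3 := mul_mem_of_inv _ a ha _ ((lat _).sub_mem (hr.mem i) (hr.mem j)) α hα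
    have h4 := (lat I).add_mem h3 h2
    have : (α : k) * (r i - r j) + γ * (r i - r j) = r i - r j := by
      linear_combination (r i - r j) * h1'
    rwa [this] at h4

lemma PP_eq_of_le (v w : PP k) (h : w.asIdeal ≤ v.asIdeal) : w = v := by
  ext1
  exact w.isMaximal.eq_of_le v.isPrime.ne_top h

lemma PP_prod_le (v : PP k) (T : Finset (PP k)) (h : ∏ w ∈ T, w.asIdeal ≤ v.asIdeal) : v ∈ T := by
  rw [← Ideal.dvd_iff_le, Prime.dvd_finsetProd_iff v.prime] at h
  obtain ⟨w, hw, h⟩ := h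
  rw [Ideal.dvd_iff_le] at h
  rwa [← PP_eq_of_le v w h]

lemma PP_prod_ne_bot (T : Finset (PP k)) : ∏ w ∈ T, w.asIdeal ≠ ⊥ := by
  rw [← Ideal.zero_eq_bot, Finset.prod_ne_zero_iff]
  intro w _; exact w.ne_bot

lemma span_two_ne_bot : (Ideal.span {2} : Ideal (𝓞 k)) ≠ ⊥ := by
  rw [Ne, Ideal.span_singleton_eq_bot]; exact two_ne_zero

lemma PP_not_sq (v : PP k) (T : Finset (PP k)) (hv : v ∈ T) :
    ¬ v.asIdeal ^ 2 ∣ ∏ w ∈ T, w.asIdeal := by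
  classical
  rw [← Finset.mul_prod_erase _ _ hv, sq]
  intro h
  have h1 := (mul_dvd_mul_iff_left (a := v.asIdeal) v.ne_bot).1 h
  rw [Ideal.dvd_iff_le] at h1
  simpa using PP_prod_le v _ h1

lemma sup_eq_top_of_not_le (v : PP k) (a : Ideal (𝓞 k)) (h : ¬ a ≤ v.asIdeal) :
    a ⊔ v.asIdeal = ⊤ := by
  rcases (v.isMaximal.out.le_iff.1 (le_sup_right : v.asIdeal ≤ a ⊔ v.asIdeal)) with h4 | h4
  · exact h4
  · exact absurd (h4 ▸ le_sup_left) h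

lemma tsum (β : k) (I : FI k) (hI : I ≠ 0) (T0 : Finset (PP k))
    (h : spanSingleton _ β * I ^ 2 = ((∏ v ∈ T0, v.asIdeal : Ideal (𝓞 k)) : FI k) * Dv k)
    (h2 : ∀ v ∈ T0, (2 : 𝓞 k) ∉ v.asIdeal) (u : 𝓞 k) (hu : u - 1 ∈ Ideal.span {(4 : 𝓞 k)})
    (huT : ∀ v ∈ T0, u ∉ v.asIdeal) : ∀ T ⊆ T0,
    ∃ (κ : Type) (_ : Fintype κ) (r : κ → k),
      IsTrv (lat (I * ((Ideal.span {2} * ∏ v ∈ T, v.asIdeal : Ideal (𝓞 k)) : FI k)⁻¹)) (lat I) r ∧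
      ∑ i, ee (Algebra.trace ℚ k (u * β * r i * r i)) =
      ((∏ v ∈ T, chi v u : ℤ) : ℂ) * ∑ i, ee (Algebra.trace ℚ k (β * r i * r i)) := by
  classical
  intro T
  induction T using Finset.induction_on with
  | empty =>
    intro _
    rw [Finset.prod_empty, mul_one]
    obtain ⟨n, r, hr⟩ := exists_trv (I := I) (J := I * ((Ideal.span {2} : Ideal (𝓞 k)) : FI k)⁻¹) hI
    refine ⟨Fin n, inferInstance, r, hr, ?_⟩
    simp only [Finset.prod_empty, Int.cast_one, one_mul]
    refine Finset.sum_congr rfl fun i _ => ?_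
    obtain ⟨d, hd⟩ := Ideal.mem_span_singleton.1 hu
    have hd' : (u : k) = 1 + 4 * d := by
      have h3 : u = 1 + 2 * 2 * d := by linear_combination hd
      rw [h3, co_add, co_mul, co_mul, co_two, co_one]; norm_num
    have h3 : (2 : k) * r i ∈ I := by
      have := mul_mem_of_inv _ _ span_two_ne_bot _ (hr.mem i) 2 (Ideal.mem_span_singleton_self 2)
      rwa [co_two] at this
    have h4 : β * ((2 * r i) * (2 * r i)) ∈ Dv k := by
      have h5 : β * ((2 * r i) * (2 * r i)) ∈ spanSingleton (𝓞 k)⁰ β * I ^ 2 := by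
        rw [sq]; exact mul_mem_mul (mem_spanSingleton_self _ _) (mul_mem_mul h3 h3)
      rw [h] at h5
      have : ((∏ v ∈ T0, v.asIdeal : Ideal (𝓞 k)) : FI k) * Dv k ≤ 1 * Dv k := by
        gcongr; exact coeIdeal_le_one
      rw [one_mul] at this
      exact this h5
    rw [hd', show (1 + 4 * (d : k)) * β * r i * r i = β * r i * r i +
      d * (β * ((2 * r i) * (2 * r i))) by ring, map_add, ee_add_isI]
    exact isI_of_mem_Dv (FI_smul _ _ _ h4)
  | insert v T hv ih =>
    intro hT
    have hvT0 := hT (Finset.mem_insert_self _ _)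
    obtain ⟨κ, hκ, r, hr, e⟩ := ih ((Finset.subset_insert _ _).trans hT)
    obtain ⟨n, s, hs⟩ := exists_trv (I := I) (J := I * (v.asIdeal : FI k)⁻¹) hI
    have ha : (Ideal.span {2} * ∏ v ∈ T, v.asIdeal : Ideal (𝓞 k)) ≠ ⊥ :=
      mul_ne_zero span_two_ne_bot (PP_prod_ne_bot T)
    have hcop : (Ideal.span {2} * ∏ v ∈ T, v.asIdeal : Ideal (𝓞 k)) ⊔ v.asIdeal = ⊤ := by
      apply sup_eq_top_of_not_le
      rw [← Ideal.dvd_iff_le, v.prime.dvd_mul]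
      rintro (h3 | h3)
      · rw [Ideal.dvd_iff_le, Ideal.span_singleton_le_iff_mem] at h3
        exact h2 v hvT0 h3
      · exact hv (PP_prod_le v T (Ideal.dvd_iff_le.1 h3))
    have hr' := coprime_trv I _ _ ha v.ne_bot hcop hr
    have hle1 : lat I ≤ lat (I * (v.asIdeal : FI k)⁻¹) := le_mul_inv _ _ v.ne_bot
    have hle2 : lat (I * (v.asIdeal : FI k)⁻¹) ≤ lat (I *
        ((Ideal.span {2} * ∏ v ∈ T, v.asIdeal : Ideal (𝓞 k)) : FI k)⁻¹ * (v.asIdeal : FI k)⁻¹) := by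
      rw [mul_right_comm]
      exact lat_mono (le_mul_inv _ _ ha)
    have hc := IsTrv.comp hle1 hle2 hr' hs
    refine ⟨κ × Fin n, inferInstance, fun p => r p.1 + s p.2, ?_, ?_⟩
    · convert hc using 2
      rw [Finset.prod_insert hv, mul_left_comm, coeIdeal_mul, mul_inv, mul_assoc, mul_comm (_⁻¹) _]
    have hcross : ∀ i j, 2 * β * r i * s j ∈ Dv k := by
      intro i j
      have h3 : 2 * (β * (r i * s j)) ∈ spanSingleton (𝓞 k)⁰ 2 * (spanSingleton (𝓞 k)⁰ β *
        (I * ((Ideal.span {2} * ∏ v ∈ T, v.asIdeal : Ideal (𝓞 k)) : FI k)⁻¹ *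
          (I * (v.asIdeal : FI k)⁻¹))) :=
        mul_mem_mul (mem_spanSingleton_self _ _) (mul_mem_mul (mem_spanSingleton_self _ _)
          (mul_mem_mul (hr.mem i) (hs.mem j)))
      rw [show 2 * β * r i * s j = 2 * (β * (r i * s j)) by ring]
      refine (?_ : _ ≤ Dv k) h3
      have hsp : spanSingleton (𝓞 k)⁰ (2 : k) = ((Ideal.span {2} : Ideal (𝓞 k)) : FI k) := by
        rw [coeIdeal_span_singleton, map_ofNat]
      have hv0 : (v.asIdeal : FI k) ≠ 0 := coeIdeal_ne_zero.2 v.ne_bot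
      have h20 : ((Ideal.span {2} : Ideal (𝓞 k)) : FI k) ≠ 0 := coeIdeal_ne_zero.2 span_two_ne_bot
      have hT0 : ((∏ v ∈ T, v.asIdeal : Ideal (𝓞 k)) : FI k) ≠ 0 :=
        coeIdeal_ne_zero.2 (PP_prod_ne_bot T)
      have h4 : ((∏ v ∈ T0, v.asIdeal : Ideal (𝓞 k)) : FI k) ≤
          (v.asIdeal : FI k) * ((∏ v ∈ T, v.asIdeal : Ideal (𝓞 k)) : FI k) := by
        rw [← coeIdeal_mul, coeIdeal_le_coeIdeal, ← Finset.prod_insert hv, ← Ideal.dvd_iff_le]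
        exact Finset.prod_dvd_prod_of_subset _ _ _ hT
      calc _ = (spanSingleton (𝓞 k)⁰ β * I ^ 2) * ((v.asIdeal : FI k) *
              ((∏ v ∈ T, v.asIdeal : Ideal (𝓞 k)) : FI k))⁻¹ := by
            rw [hsp, coeIdeal_mul]; field_simp
        _ = ((∏ v ∈ T0, v.asIdeal : Ideal (𝓞 k)) : FI k) * (Dv k * ((v.asIdeal : FI k) *
              ((∏ v ∈ T, v.asIdeal : Ideal (𝓞 k)) : FI k))⁻¹) := by rw [h]; ring
        _ ≤ ((v.asIdeal : FI k) * ((∏ v ∈ T, v.asIdeal : Ideal (𝓞 k)) : FI k)) * (Dv k *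
            ((v.asIdeal : FI k) * ((∏ v ∈ T, v.asIdeal : Ideal (𝓞 k)) : FI k))⁻¹) := by gcongr
        _ = Dv k := by field_simp
    have hfac : ∀ a : 𝓞 k, ∑ p : κ × Fin n, ee (Algebra.trace ℚ k (a * β * (r p.1 + s p.2) *
        (r p.1 + s p.2))) = (∑ i, ee (Algebra.trace ℚ k (a * β * r i * r i))) *
        ∑ j, ee (Algebra.trace ℚ k (a * β * s j * s j)) := by
      intro a
      rw [Fintype.sum_mul_sum, Fintype.sum_prod_type]
      refine Finset.sum_congr rfl fun i _ => Finset.sum_congr rfl fun j _ => ?_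
      rw [← ee_add, ← map_add, show (a : k) * β * (r i + s j) * (r i + s j) =
        (a * β * r i * r i + a * β * s j * s j) + a * (2 * β * r i * s j) by ring, map_add _ _
        ((a : k) * (2 * β * r i * s j)), ee_add_isI]
      exact isI_of_mem_Dv (FI_smul _ _ _ (hcross i j))
    have hp := ppart β I hI _ h v (h2 v hvT0) (Finset.dvd_prod_of_mem _ hvT0) (PP_not_sq v T0 hvT0)
      hs u (huT v hvT0)
    have hf1 := hfac 1
    simp only [co_one, one_mul] at hf1
    rw [hfac u, hf1, e, hp, Finset.prod_insert hv]
    push_cast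
    ring

/-- the fundamental identity -/
lemma fund (β : k) (hβ : β ≠ 0) (I : FI k) (hI : I ≠ 0) (T : Finset (PP k))
    (h : spanSingleton _ β * I ^ 2 = ((∏ v ∈ T, v.asIdeal : Ideal (𝓞 k)) : FI k) * Dv k)
    (h2 : ∀ v ∈ T, (2 : 𝓞 k) ∉ v.asIdeal) (u : 𝓞 k) (hu0 : u ≠ 0)
    (hu : u - 1 ∈ Ideal.span {(4 : 𝓞 k)})
    (huT : ∀ v ∈ T, u ∉ v.asIdeal) (q : Ideal (𝓞 k)) (hq : Ideal.span {u} = q ^ 2) :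
    ∃ (s s' : ℚ) (c c' : ℝ), HasSig β s ∧ HasSig (u * β) s' ∧ 0 < c ∧ 0 < c' ∧
      ((∏ v ∈ T, chi v u : ℤ) : ℂ) * (c * ee s) = c' * ee s' := by
  obtain ⟨κ, hκ, r, hr, e⟩ := tsum β I hI T h h2 u hu huT T subset_rfl
  have hq0 : q ≠ ⊥ := by
    rintro rfl
    rw [← Ideal.zero_eq_bot, zero_pow two_ne_zero, Ideal.zero_eq_bot,
      Ideal.span_singleton_eq_bot] at hq
    exact hu0 hq
  have hq0' : (q : FI k) ≠ 0 := coeIdeal_ne_zero.2 hq0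
  have hT0 : ((∏ v ∈ T, v.asIdeal : Ideal (𝓞 k)) : FI k) ≠ 0 :=
        coeIdeal_ne_zero.2 (PP_prod_ne_bot T)
  have hsp : ((Ideal.span {2} : Ideal (𝓞 k)) : FI k) = spanSingleton (𝓞 k)⁰ (2 : k) := by
        rw [coeIdeal_span_singleton, map_ofNat]
  have hcop : (Ideal.span {2} * ∏ v ∈ T, v.asIdeal : Ideal (𝓞 k)) ⊔ q = ⊤ := by
    by_contra hne
    obtain ⟨m, hm, hle⟩ := Ideal.exists_le_maximal _ hne
    have hqm : q ≤ m := le_sup_right.trans hle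
    have hum : u ∈ m := by
      have : u ∈ q ^ 2 := hq ▸ Ideal.mem_span_singleton_self u
      exact hqm (Ideal.pow_le_self two_ne_zero this)
    have hm0 : m ≠ ⊥ := by rintro rfl; exact hq0 (le_bot_iff.1 hqm)
    let v : PP k := ⟨m, hm.isPrime, hm0⟩
    have h3 : (Ideal.span {2} * ∏ v ∈ T, v.asIdeal : Ideal (𝓞 k)) ≤ m := le_sup_left.trans hle
    rw [← Ideal.dvd_iff_le, v.prime.dvd_mul] at h3
    rcases h3 with h3 | h3
    · rw [Ideal.dvd_iff_le, Ideal.span_singleton_le_iff_mem] at h3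
      obtain ⟨d, hd⟩ := Ideal.mem_span_singleton.1 hu
      apply hm.ne_top
      rw [Ideal.eq_top_iff_one, show (1 : 𝓞 k) = u - 2 * (2 * d) by linear_combination (-1) * hd]
      exact m.sub_mem hum (m.mul_mem_right _ h3)
    · exact huT v (PP_prod_le v T (Ideal.dvd_iff_le.1 h3)) hum
  have hr' := coprime_trv I _ _ (mul_ne_zero span_two_ne_bot (PP_prod_ne_bot T)) hq0 hcop hr
  rw [coeIdeal_mul, hsp] at hr hr'
  rw [mul_right_comm] at hr'
  obtain ⟨s, c, hs, hc, e1⟩ := milgramFI β hβ I _ hI hT0 coeIdeal_le_one h hr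
  have h' : spanSingleton _ ((u : k) * β) * (I * (q : FI k)⁻¹) ^ 2 =
      ((∏ v ∈ T, v.asIdeal : Ideal (𝓞 k)) : FI k) * Dv k := by
    rw [← h, ← spanSingleton_mul_spanSingleton]
    have : spanSingleton (𝓞 k)⁰ (u : k) = (q : FI k) ^ 2 := by
      rw [← coeIdeal_pow, ← hq, coeIdeal_span_singleton]
    rw [this]; field_simp
  have huk : (u : k) ≠ 0 := by simpa using hu0
  obtain ⟨s', c', hs', hc', e2⟩ := milgramFI ((u : k) * β) (mul_ne_zero huk hβ)
    (I * (q : FI k)⁻¹) _ (mul_ne_zero hI (inv_ne_zero hq0')) hT0 coeIdeal_le_one h' hr'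
  exact ⟨s, s', c, c', hs, hs', hc, hc', by rw [← e2, e, e1]⟩

end dd
end Cub

open NumberField
namespace Cub
open Module
open scoped nonZeroDivisors

section dd
set_option linter.unusedSectionVars false
variable {k : Type*} [Field k] [NumberField k]
open FractionalIdeal

lemma ee_ne_zero (x : ℚ) : ee x ≠ 0 := by
  intro h
  have := ee_add x (-x)
  rw [add_neg_cancel, ee_zero, h, zero_mul] at this
  exact one_ne_zero this

lemma prod_pm {ι : Type*} (T : Finset ι) (f : ι → ℤ) (h : ∀ i ∈ T, f i = 1 ∨ f i = -1) :
    ∏ i ∈ T, f i = 1 ∨ ∏ i ∈ T, f i = -1 := by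
  classical
  induction T using Finset.induction_on with
  | empty => simp
  | insert a T ha ih =>
    rw [Finset.prod_insert ha]
    rcases ih (fun i hi => h i (Finset.mem_insert_of_mem hi)) with h1 | h1 <;>
    rcases h a (Finset.mem_insert_self _ _) with h2 | h2 <;> simp [h1, h2]

/-- data attached to `β` -/
structure Good (β : k) (I : FI k) (T : Finset (PP k)) : Prop where
  hβ : β ≠ 0
  hI : I ≠ 0
  h : spanSingleton _ β * I ^ 2 = ((∏ v ∈ T, v.asIdeal : Ideal (𝓞 k)) : FI k) * Dv k
  h2 : ∀ v ∈ T, (2 : 𝓞 k) ∉ v.asIdeal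

lemma pm_pos {e : ℤ} (he : e = 1 ∨ e = -1) {c c' : ℝ} (hc : 0 < c) (hc' : 0 < c')
    (h : (e : ℂ) * c = c') : e = 1 := by
  rcases he with rfl | rfl
  · rfl
  · exfalso
    have : ((-1 : ℤ) : ℝ) * c = c' := by exact_mod_cast h
    push_cast at this
    linarith

lemma cons1 {β : k} {I : FI k} {T : Finset (PP k)} (g : Good β I T) (u : 𝓞 k) (hu0 : u ≠ 0)
    (hu : u - 1 ∈ Ideal.span {(4 : 𝓞 k)})
    (huT : ∀ v ∈ T, u ∉ v.asIdeal) (q : Ideal (𝓞 k)) (hq : Ideal.span {u} = q ^ 2)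
    (hpos : ∀ φ : k →+* ℝ, 0 < φ u) : ∏ v ∈ T, chi v u = 1 := by
  obtain ⟨s, s', c, c', hs, hs', hc, hc', e⟩ := fund β g.hβ I g.hI T g.h g.h2 u hu0 hu huT q hq
  have huk : (u : k) ≠ 0 := by simpa using hu0
  have := hs.unique hs' g.hβ (mul_ne_zero huk g.hβ) (fun φ => by
    rw [mul_div_cancel_right₀ _ g.hβ]; exact hpos φ)
  subst this
  rw [← mul_assoc] at e
  exact pm_pos (prod_pm T _ fun v hv => chi_dichotomy v u (huT v hv)) hc hc'
    (mul_right_cancel₀ (ee_ne_zero s) e)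

lemma cons2 {β : k} {I : FI k} {T : Finset (PP k)} (g : Good β I T) 
    {β₁ : k} {I₁ : FI k} {T₁ : Finset (PP k)} (g₁ : Good β₁ I₁ T₁) (u : 𝓞 k) (hu0 : u ≠ 0)
    (hu : u - 1 ∈ Ideal.span {(4 : 𝓞 k)})
    (huT : ∀ v ∈ T, u ∉ v.asIdeal) (huT₁ : ∀ v ∈ T₁, u ∉ v.asIdeal)
    (q : Ideal (𝓞 k)) (hq : Ideal.span {u} = q ^ 2)
    (hpos : ∀ φ : k →+* ℝ, 0 < φ (β₁ / β)) : ∏ v ∈ T, chi v u = ∏ v ∈ T₁, chi v u := by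
  obtain ⟨s, s', c, c', hs, hs', hc, hc', e⟩ := fund β g.hβ I g.hI T g.h g.h2 u hu0 hu huT q hq
  obtain ⟨s₁, s₁', c₁, c₁', hs₁, hs₁', hc₁, hc₁', e₁⟩ :=
    fund β₁ g₁.hβ I₁ g₁.hI T₁ g₁.h g₁.h2 u hu0 hu huT₁ q hq
  have huk : (u : k) ≠ 0 := by simpa using hu0
  have := hs.unique hs₁ g.hβ g₁.hβ hpos
  subst this
  have := hs'.unique hs₁' (mul_ne_zero huk g.hβ) (mul_ne_zero huk g₁.hβ) (fun φ => by
    rw [mul_div_mul_left _ _ huk]; exact hpos φ)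
  subst this
  have hT := prod_pm T _ fun v hv => chi_dichotomy v u (huT v hv)
  have hT₁ := prod_pm T₁ _ fun v hv => chi_dichotomy v u (huT₁ v hv)
  set X := ∏ v ∈ T, chi v u
  set Y := ∏ v ∈ T₁, chi v u
  have hY : Y * Y = 1 := by rcases hT₁ with h | h <;> rw [h] <;> norm_num
  have h1 : X * Y = 1 := by
    refine pm_pos (c := c * c₁') (c' := c' * c₁) ?_ (by positivity) (by positivity) ?_
    · rcases hT with h | h <;> rcases hT₁ with h' | h' <;> rw [h, h'] <;> norm_num
    · apply mul_right_cancel₀ (mul_ne_zero (ee_ne_zero s) (ee_ne_zero s'))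
      have hYc : (Y : ℂ) * Y = 1 := by exact_mod_cast hY
      push_cast
      linear_combination (c' * ee s') * (-Y * e₁ + c₁ * ee s * hYc) + (Y * c₁' * ee s') * e
  calc X = X * (Y * Y) := by rw [hY, mul_one]
    _ = Y := by rw [← mul_assoc, h1, one_mul]

/-- twisting by a virtual unit -/
lemma Good.twist {β : k} {I : FI k} {T : Finset (PP k)} (g : Good β I T) (u : 𝓞 k) (hu0 : u ≠ 0)
    (q : Ideal (𝓞 k)) (hq : Ideal.span {u} = q ^ 2) : Good ((u : k) * β) (I * (q : FI k)⁻¹) T := by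
  have hq0 : q ≠ ⊥ := by
    rintro rfl
    rw [← Ideal.zero_eq_bot, zero_pow two_ne_zero, Ideal.zero_eq_bot,
      Ideal.span_singleton_eq_bot] at hq
    exact hu0 hq
  have hq0' : (q : FI k) ≠ 0 := coeIdeal_ne_zero.2 hq0
  have huk : (u : k) ≠ 0 := by simpa using hu0
  refine ⟨mul_ne_zero huk g.hβ, mul_ne_zero g.hI (inv_ne_zero hq0'), ?_, g.h2⟩
  rw [← g.h, ← spanSingleton_mul_spanSingleton]
  have : spanSingleton (𝓞 k)⁰ (u : k) = (q : FI k) ^ 2 := by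
    rw [← coeIdeal_pow, ← hq, coeIdeal_span_singleton]
  rw [this]; field_simp

end dd
end Cub

open NumberField
namespace Cub
open Module
open scoped nonZeroDivisors ENNReal

section ee1
set_option linter.unusedSectionVars false

/-- formal Euler product -/
noncomputable def Zf {ι : Type*} (w : ι → ℝ≥0∞) : ℝ≥0∞ := ∑' f : ι →₀ ℕ, f.prod (fun i n => w i ^ n)

lemma Zf_inj {ι κ : Type*} (w : ι → ℝ≥0∞) (w' : κ → ℝ≥0∞) (g : ι → κ) (hg : Function.Injective g)
    (h : ∀ i, w i ≤ w' (g i)) : Zf w ≤ Zf w' := by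
  refine le_trans ?_ (ENNReal.tsum_comp_le_tsum_of_injective (Finsupp.mapDomain_injective hg) _)
  refine ENNReal.tsum_le_tsum fun f => ?_
  rw [Finsupp.prod_mapDomain_index_inj hg]
  exact Finset.prod_le_prod' fun i _ => pow_le_pow_left' (h i) _

lemma Zf_sum {ι κ : Type*} (w : ι ⊕ κ → ℝ≥0∞) :
    Zf w = Zf (fun i => w (.inl i)) * Zf (fun i => w (.inr i)) := by
  unfold Zf
  rw [← Equiv.tsum_eq (Finsupp.sumFinsuppEquivProdFinsupp).symm, ENNReal.tsum_prod',
    ← ENNReal.tsum_mul_right]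
  refine tsum_congr fun f => ?_
  rw [← ENNReal.tsum_mul_left]
  refine tsum_congr fun g => ?_
  change (Finsupp.sumElim f g).prod _ = _
  rw [Finsupp.prod_sumElim]
  rfl

lemma Zf_unit (w : PUnit → ℝ≥0∞) (h : w PUnit.unit ≤ 2⁻¹) : Zf w ≤ 2 := by
  unfold Zf
  rw [← Equiv.tsum_eq (Finsupp.LinearEquiv.finsuppUnique ℕ ℕ PUnit).symm.toEquiv]
  calc _ ≤ ∑' n : ℕ, (2⁻¹ : ℝ≥0∞) ^ n := by
        refine ENNReal.tsum_le_tsum fun n => ?_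
        have : ((Finsupp.LinearEquiv.finsuppUnique ℕ ℕ PUnit).symm.toEquiv n : PUnit →₀ ℕ) =
          Finsupp.single PUnit.unit n := by
          ext; simp [Finsupp.LinearEquiv.finsuppUnique]
        rw [this, Finsupp.prod_single_index (by simp)]
        exact pow_le_pow_left' h _
    _ = 2 := by rw [ENNReal.tsum_geometric]; norm_num

lemma Zf_finite (ι : Type*) [Finite ι] : ∃ C : ℝ≥0∞, C ≠ ⊤ ∧ ∀ w : ι → ℝ≥0∞, (∀ i, w i ≤ 2⁻¹) →
    Zf w ≤ C := by
  induction ι using Finite.induction_empty_option with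
  | of_equiv e ih =>
    obtain ⟨C, hC, h⟩ := ih
    refine ⟨C, hC, fun w hw => ?_⟩
    exact (Zf_inj w (fun i => w (e i)) e.symm e.symm.injective (by simp)).trans (h _ fun i => hw _)
  | h_empty =>
    refine ⟨1, ENNReal.one_ne_top, fun w _ => ?_⟩
    unfold Zf
    rw [tsum_eq_single 0 (fun f hf => absurd (Subsingleton.elim _ _) hf)]
    simp
  | h_option ih =>
    rename_i α _
    obtain ⟨C, hC, h⟩ := ih
    refine ⟨C * 2, ENNReal.mul_ne_top hC (by norm_num), fun w hw => ?_⟩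
    let w' : α ⊕ PUnit.{1} → ℝ≥0∞ := fun x => w ((Equiv.optionEquivSumPUnit α).symm x)
    calc Zf w ≤ Zf w' := Zf_inj _ _ (Equiv.optionEquivSumPUnit α) (Equiv.injective _)
            (by intro i; simp only [w']; rw [Equiv.symm_apply_apply])
      _ = _ := Zf_sum w'
      _ ≤ _ := mul_le_mul' (h _ fun i => hw _) (Zf_unit _ (hw _))

variable (K : Type*) [Field K] [NumberField K]

/-- ideal with the given exponents -/
noncomputable def idl (f : PP K →₀ ℕ) : Ideal (𝓞 K) := f.prod (fun v n => v.asIdeal ^ n)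

variable {K}
lemma idl_ne_bot (f : PP K →₀ ℕ) : idl K f ≠ ⊥ := by
  rw [← Ideal.zero_eq_bot, idl, Finsupp.prod, Finset.prod_ne_zero_iff]
  intro v _; exact pow_ne_zero _ v.ne_bot

lemma idl_add (f g : PP K →₀ ℕ) : idl K (f + g) = idl K f * idl K g :=
  Finsupp.prod_add_index' (by simp) (by intros; rw [pow_add])

lemma idl_single (v : PP K) : idl K (Finsupp.single v 1) = v.asIdeal := by
  rw [idl, Finsupp.prod_single_index (by simp), pow_one]

lemma idl_inj : Function.Injective (idl K) := by
  classical
  have key : ∀ f : PP K →₀ ℕ, UniqueFactorizationMonoid.normalizedFactors (idl K f) =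
      (Finsupp.toMultiset f).map (fun v => v.asIdeal) := by
    intro f
    have : idl K f = ((Finsupp.toMultiset f).map (fun v : PP K => v.asIdeal)).prod := by
      rw [Finsupp.toMultiset_map, idl, Finsupp.prod_toMultiset, Finsupp.prod_mapDomain_index]
      · simp
      · intros; rw [pow_add]
    rw [this]
    apply UniqueFactorizationMonoid.normalizedFactors_prod_of_prime
    intro p hp
    obtain ⟨v, -, rfl⟩ := Multiset.mem_map.1 hp
    exact v.prime
  intro f g hfg
  have h1 := key f
  rw [hfg, key g] at h1
  have h2 := Multiset.map_injective (f := fun v : PP K => v.asIdeal)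
    (fun v w h => IsDedekindDomain.HeightOneSpectrum.ext h) h1
  exact (Multiset.toFinsupp.symm.injective h2).symm

lemma idl_surj (I : Ideal (𝓞 K)) (hI : I ≠ ⊥) : ∃ f, idl K f = I := by
  induction I using UniqueFactorizationMonoid.induction_on_prime with
  | h₁ => exact absurd rfl hI
  | h₂ x hx =>
    refine ⟨0, ?_⟩
    rw [Ideal.isUnit_iff.1 hx]; simp [idl, Ideal.one_eq_top]
  | h₃ a p ha hp ih =>
    obtain ⟨f, rfl⟩ := ih ha
    exact ⟨Finsupp.single ⟨p, Ideal.isPrime_of_prime hp, hp.ne_zero⟩ 1 + f, by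
      rw [idl_add, idl_single]⟩

/-- local weights -/
noncomputable def wt (s : ℝ) (v : PP K) : ℝ≥0∞ := ENNReal.ofReal ((Ideal.absNorm v.asIdeal : ℝ) ^ (-s))

lemma wt_prod (s : ℝ) (f : PP K →₀ ℕ) : f.prod (fun i n => wt s i ^ n) =
    ENNReal.ofReal ((Ideal.absNorm (idl K f) : ℝ) ^ (-s)) := by
  rw [idl, Finsupp.prod, Finsupp.prod, map_prod, Nat.cast_prod, ← Real.finset_prod_rpow,
    ENNReal.ofReal_prod_of_nonneg]
  · refine Finset.prod_congr rfl fun v _ => ?_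
    rw [wt, map_pow, Nat.cast_pow, ← ENNReal.ofReal_pow (by positivity), Real.rpow_pow_comm]
    positivity
  · intros; positivity
  · intros; positivity

lemma Zf_eq (s : ℝ) : Zf (wt (K := K) s) = ∑' n : ℕ, ENNReal.ofReal
    (if n = 0 then 0 else Nat.card {I : Ideal (𝓞 K) // Ideal.absNorm I = n} * (n : ℝ) ^ (-s)) := by
  unfold Zf
  simp only [wt_prod]
  rw [← Equiv.tsum_eq (Equiv.sigmaFiberEquiv (fun f => Ideal.absNorm (idl K f))), ENNReal.tsum_sigma']
  refine tsum_congr fun n => ?_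
  have h1 : ∀ x : {f // Ideal.absNorm (idl K f) = n}, ENNReal.ofReal ((Ideal.absNorm (idl K
      ((Equiv.sigmaFiberEquiv (fun f => Ideal.absNorm (idl K f))) ⟨n, x⟩)) : ℝ) ^ (-s)) =
      ENNReal.ofReal ((n : ℝ) ^ (-s)) := by
    intro x
    have : Ideal.absNorm (idl K
      ((Equiv.sigmaFiberEquiv (fun f => Ideal.absNorm (idl K f))) ⟨n, x⟩)) = n := x.2
    rw [this]
  simp only [h1]
  split_ifs with hn
  · have : IsEmpty {f // Ideal.absNorm (idl K f) = n} := ⟨fun x => by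
      have := x.2.trans hn
      rw [Ideal.absNorm_eq_zero_iff] at this
      exact idl_ne_bot _ this⟩
    simp
  · let e : {f // Ideal.absNorm (idl K f) = n} ≃ {I : Ideal (𝓞 K) // Ideal.absNorm I = n} :=
      Equiv.ofBijective (fun x => ⟨idl K x.1, x.2⟩) ⟨fun x y h => by
        apply Subtype.ext; exact idl_inj (congrArg Subtype.val h), fun I => by
        obtain ⟨f, hf⟩ := idl_surj I.1 (by
          intro h
          have := I.2
          rw [h, Ideal.absNorm_bot] at this
          exact hn this.symm)
        exact ⟨⟨f, by rw [hf]; exact I.2⟩, Subtype.ext hf⟩⟩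
    have hfin : Finite {I : Ideal (𝓞 K) // Ideal.absNorm I = n} :=
      Ideal.finite_setOfPred_absNorm_eq n
    have hfin' : Finite {f // Ideal.absNorm (idl K f) = n} := Finite.of_equiv _ e.symm
    rw [ENNReal.tsum_const, ENat.card_eq_coe_natCard, Nat.card_congr e,
      ENNReal.ofReal_mul (by positivity), ENNReal.ofReal_natCast]
    simp

open Filter Topology in
lemma Zf_tendsto : Tendsto (fun s : ℝ => ENNReal.ofReal (s - 1) * Zf (wt (K := K) s)) (𝓝[>] 1)
    (𝓝 (ENNReal.ofReal (dedekindZeta_residue K))) := by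
  have h0 := tendsto_sub_one_mul_dedekindZeta_nhdsGT K
  have hne : ∀ᶠ s : ℝ in 𝓝[>] 1, ((s : ℂ) - 1) * dedekindZeta K s ≠ 0 :=
    h0.eventually_ne (by exact_mod_cast dedekindZeta_residue_ne_zero K)
  have h1 : Tendsto (fun s : ℝ => (((s : ℂ) - 1) * dedekindZeta K s).re) (𝓝[>] 1)
    (𝓝 (dedekindZeta_residue K)) := by
    have := (Complex.continuous_re.tendsto _).comp h0
    rw [Complex.ofReal_re] at this
    exact this
  refine ((ENNReal.continuous_ofReal.tendsto _).comp h1).congr' ?_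
  filter_upwards [hne, self_mem_nhdsWithin] with s hs hs1
  have hs1 : 1 < s := hs1
  have hz : dedekindZeta K s ≠ 0 := right_ne_zero_of_mul hs
  have hsum : LSeriesSummable (fun n ↦ Nat.card {I : Ideal (𝓞 K) // Ideal.absNorm I = n}) s := by
    by_contra h
    exact hz (tsum_eq_zero_of_not_summable h)
  have hterm : ∀ n, LSeries.term (fun n ↦ Nat.card {I : Ideal (𝓞 K) // Ideal.absNorm I = n}) s n =
      ((if n = 0 then 0 else Nat.card {I : Ideal (𝓞 K) // Ideal.absNorm I = n} * (n : ℝ) ^ (-s) : ℝ) :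
        ℂ) := by
    intro n
    rw [LSeries.term_def]
    split_ifs with hn
    · simp
    · push_cast
      rw [Complex.ofReal_cpow (by positivity), div_eq_mul_inv]
      push_cast
      rw [Complex.cpow_neg]
  have hsum' : Summable (fun n : ℕ => (if n = 0 then 0 else
      Nat.card {I : Ideal (𝓞 K) // Ideal.absNorm I = n} * (n : ℝ) ^ (-s) : ℝ)) := by
    have := hsum
    unfold LSeriesSummable at this
    rw [funext hterm] at this
    exact Complex.summable_ofReal.1 this
  have hval : dedekindZeta K s = ((∑' n : ℕ, (if n = 0 then 0 else
      Nat.card {I : Ideal (𝓞 K) // Ideal.absNorm I = n} * (n : ℝ) ^ (-s) : ℝ) : ℝ) : ℂ) := by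
    rw [dedekindZeta, LSeries, tsum_congr hterm, Complex.ofReal_tsum]
  rw [Function.comp_apply, hval, Zf_eq, ← ENNReal.ofReal_tsum_of_nonneg _ hsum',
    ← ENNReal.ofReal_mul (by linarith)]
  · congr 1
    rw [← Complex.ofReal_one, ← Complex.ofReal_sub, ← Complex.ofReal_mul, Complex.ofReal_re]
  · intro n
    split_ifs
    · exact le_rfl
    · positivity

end ee1
end Cub

open NumberField
namespace Cub
open Module
open scoped nonZeroDivisors ENNReal

section ee2
set_option linter.unusedSectionVars false
variable {K L : Type*} [Field K] [NumberField K] [Field L] [NumberField L]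

lemma absNorm_ge_two (v : PP K) : 2 ≤ Ideal.absNorm v.asIdeal := by
  have h0 : Ideal.absNorm v.asIdeal ≠ 0 := by
    rw [Ne, Ideal.absNorm_eq_zero_iff]; exact v.ne_bot
  have h1 : Ideal.absNorm v.asIdeal ≠ 1 := by
    rw [Ne, Ideal.absNorm_eq_one_iff]; exact v.isPrime.ne_top
  omega

lemma wt_le_half (s : ℝ) (hs : 1 < s) (v : PP K) : wt s v ≤ 2⁻¹ := by
  rw [wt, show (2⁻¹ : ℝ≥0∞) = ENNReal.ofReal (2⁻¹) by
    rw [ENNReal.ofReal_inv_of_pos (by norm_num)]; norm_num]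
  apply ENNReal.ofReal_le_ofReal
  have h2 : (2 : ℝ) ≤ Ideal.absNorm v.asIdeal := by exact_mod_cast absNorm_ge_two v
  calc (Ideal.absNorm v.asIdeal : ℝ) ^ (-s) ≤ 2 ^ (-s) :=
        Real.rpow_le_rpow_of_nonpos (by norm_num) h2 (by linarith)
    _ ≤ 2 ^ (-1 : ℝ) := Real.rpow_le_rpow_of_exponent_le (by norm_num) (by linarith)
    _ = _ := by rw [Real.rpow_neg_one]

open Filter Topology in
lemma no_split (B : Set (PP K)) (hB : B.Finite) (P P' : (Bᶜ : Set (PP K)) → PP L)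
    (hinj : Function.Injective (Sum.elim P P'))
    (hP : ∀ v, Ideal.absNorm (P v).asIdeal ≤ Ideal.absNorm v.1.asIdeal)
    (hP' : ∀ v, Ideal.absNorm (P' v).asIdeal ≤ Ideal.absNorm v.1.asIdeal) : False := by
  classical
  have : Finite B := hB
  obtain ⟨C, hC, hCB⟩ := Zf_finite B
  have hw : ∀ (s : ℝ) (hs : 1 < s) (v : PP K) (w : PP L), Ideal.absNorm w.asIdeal ≤
      Ideal.absNorm v.asIdeal → wt s v ≤ wt s w := by
    intro s hs v w h
    refine ENNReal.ofReal_le_ofReal (Real.rpow_le_rpow_of_nonpos ?_ (by exact_mod_cast h)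
      (by linarith))
    have := absNorm_ge_two w
    positivity
  have h1 : ∀ s : ℝ, 1 < s → Zf (wt (K := K) s) * Zf (wt (K := K) s) ≤ C * C *
      Zf (wt (K := L) s) := by
    intro s hs
    let wg : (Bᶜ : Set (PP K)) → ℝ≥0∞ := fun v => wt s v.1
    have e1 : Zf (wt (K := K) s) ≤ C * Zf wg := by
      calc _ ≤ Zf (fun x : B ⊕ (Bᶜ : Set (PP K)) => wt s (Equiv.Set.sumCompl B x)) :=
            Zf_inj _ _ (Equiv.Set.sumCompl B).symm (Equiv.injective _) (by intro i; simp)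
        _ = _ := Zf_sum _
        _ ≤ _ := by
            gcongr
            · exact hCB _ fun i => wt_le_half s hs _
            · exact Zf_inj _ _ id Function.injective_id (by intro i; simp [wg])
    have e2 : Zf wg * Zf wg ≤ Zf (wt (K := L) s) := by
      have := Zf_sum (fun x : (Bᶜ : Set (PP K)) ⊕ (Bᶜ : Set (PP K)) => Sum.elim wg wg x)
      simp only [Sum.elim_inl, Sum.elim_inr] at this
      change _ = Zf wg * Zf wg at this
      rw [← this]
      refine Zf_inj _ _ _ hinj ?_
      rintro (v | v)
      · exact hw s hs _ _ (hP v)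
      · exact hw s hs _ _ (hP' v)
    calc _ ≤ (C * Zf wg) * (C * Zf wg) := mul_le_mul' e1 e1
      _ = C * C * (Zf wg * Zf wg) := by ring
      _ ≤ _ := by gcongr
  have h2 : ∀ᶠ s : ℝ in 𝓝[>] 1,
      (ENNReal.ofReal (s - 1) * Zf (wt (K := K) s)) * (ENNReal.ofReal (s - 1) * Zf (wt (K := K) s)) ≤
      (C * C * ENNReal.ofReal (s - 1)) * (ENNReal.ofReal (s - 1) * Zf (wt (K := L) s)) := by
    filter_upwards [self_mem_nhdsWithin] with s hs
    calc _ = ENNReal.ofReal (s - 1) * ENNReal.ofReal (s - 1) *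
            (Zf (wt (K := K) s) * Zf (wt (K := K) s)) := by ring
      _ ≤ ENNReal.ofReal (s - 1) * ENNReal.ofReal (s - 1) * (C * C * Zf (wt (K := L) s)) := by
          exact mul_le_mul' le_rfl (h1 s hs)
      _ = _ := by ring
  have hz : Tendsto (fun s : ℝ => C * C * ENNReal.ofReal (s - 1)) (𝓝[>] 1) (𝓝 0) := by
    have : Tendsto (fun s : ℝ => ENNReal.ofReal (s - 1)) (𝓝[>] 1) (𝓝 0) := by
      have h3 : Tendsto (fun s : ℝ => ENNReal.ofReal (s - 1)) (𝓝 1) (𝓝 (ENNReal.ofReal (1 - 1))) :=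
        (ENNReal.continuous_ofReal.comp (by fun_prop : Continuous fun s : ℝ => s - 1)).tendsto 1
      rw [sub_self, ENNReal.ofReal_zero] at h3
      exact h3.mono_left nhdsWithin_le_nhds
    have := ENNReal.Tendsto.const_mul this (Or.inr (ENNReal.mul_ne_top hC hC))
    simpa using this
  have hl := ENNReal.Tendsto.mul (Zf_tendsto (K := K)) (Or.inr ENNReal.ofReal_ne_top)
    (Zf_tendsto (K := K)) (Or.inr ENNReal.ofReal_ne_top)
  have hr := ENNReal.Tendsto.mul hz (Or.inr ENNReal.ofReal_ne_top)
    (Zf_tendsto (K := L)) (Or.inr (ENNReal.zero_ne_top))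
  have hle := le_of_tendsto_of_tendsto hl hr h2
  rw [zero_mul, nonpos_iff_eq_zero, mul_self_eq_zero, ENNReal.ofReal_eq_zero] at hle
  exact absurd hle (not_le.2 (dedekindZeta_residue_pos K))

variable [Algebra K L]

lemma split_prime (u : 𝓞 K) (s : 𝓞 L) (hs : s * s = algebraMap (𝓞 K) (𝓞 L) u)
    (hL : finrank K L = 2)
    (σ : 𝓞 L ≃ₐ[𝓞 K] 𝓞 L) (hσ : σ s = -s) (v : PP K) (h2 : (2 : 𝓞 K) ∉ v.asIdeal)
    (hu : u ∉ v.asIdeal) (a : 𝓞 K) (ha : u - a * a ∈ v.asIdeal) :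
    ∃ P P' : PP L, P ≠ P' ∧ P.asIdeal.comap (algebraMap (𝓞 K) (𝓞 L)) = v.asIdeal ∧
      P'.asIdeal.comap (algebraMap (𝓞 K) (𝓞 L)) = v.asIdeal ∧
      Ideal.absNorm P.asIdeal ≤ Ideal.absNorm v.asIdeal ∧
      Ideal.absNorm P'.asIdeal ≤ Ideal.absNorm v.asIdeal := by
  classical
  have hvm := v.isMaximal
  obtain ⟨Q, hQ⟩ := Ideal.exists_maximal_ideal_liesOver_of_isIntegral (S := 𝓞 L) v.asIdeal
  obtain ⟨hQm, hQl⟩ := hQ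
  have hinjm : Function.Injective (algebraMap (𝓞 K) (𝓞 L)) := FaithfulSMul.algebraMap_injective _ _
  have hne : ∀ Q : Ideal (𝓞 L), Q.comap (algebraMap (𝓞 K) (𝓞 L)) = v.asIdeal → Q ≠ ⊥ := by
    rintro Q hQ rfl
    apply v.ne_bot
    rw [← hQ, ← RingHom.ker_eq_comap_bot, (RingHom.injective_iff_ker_eq_bot _).1 hinjm]
  have hQc : Q.comap (algebraMap (𝓞 K) (𝓞 L)) = v.asIdeal := hQl.over.symm
  let P : PP L := ⟨Q, hQm.isPrime, hne Q hQc⟩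
  have hQ'c : (Q.comap (σ : 𝓞 L →+* 𝓞 L)).comap (algebraMap (𝓞 K) (𝓞 L)) = v.asIdeal := by
    rw [Ideal.comap_comap, ← hQc]
    congr 1
    ext x; simp
  let P' : PP L := ⟨Q.comap (σ : 𝓞 L →+* 𝓞 L), hQm.isPrime.comap _, hne _ hQ'c⟩
  have hPP : P ≠ P' := by
    intro hPP
    have hmem : ∀ x, x ∈ Q ↔ σ x ∈ Q := by
      intro x
      have := congrArg (fun R : PP L => x ∈ R.asIdeal) hPP
      exact iff_of_eq this
    have h3 : (s - algebraMap _ _ a) * (s + algebraMap _ _ a) ∈ Q := by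
      have : (s - algebraMap _ _ a) * (s + algebraMap _ _ a) = algebraMap (𝓞 K) (𝓞 L) (u - a * a) := by
        rw [map_sub, ← hs, map_mul]; ring
      rw [this]
      rw [← hQc] at ha
      exact ha
    have h4 : ∀ b : 𝓞 K, s - algebraMap _ _ b ∈ Q → b ∈ v.asIdeal := by
      intro b hb
      have h5 := (hmem _).1 hb
      rw [map_sub, hσ, AlgEquiv.commutes] at h5
      have h6 := Q.add_mem hb h5
      have h7 : algebraMap (𝓞 K) (𝓞 L) (2 * b) ∈ Q := by
        have := Q.neg_mem h6
        convert this using 1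
        rw [map_mul, map_ofNat]; ring
      have h8 : 2 * b ∈ v.asIdeal := by rw [← hQc]; exact h7
      exact (v.isPrime.mem_or_mem h8).resolve_left h2
    have h5 : a ∈ v.asIdeal := by
      rcases hQm.isPrime.mem_or_mem h3 with h | h
      · exact h4 a h
      · have := h4 (-a) (by simpa using h)
        simpa using this
    apply hu
    have := v.asIdeal.add_mem ha (v.asIdeal.mul_mem_left a h5)
    simpa using this
  have hl1 : P.asIdeal.LiesOver v.asIdeal := ⟨hQc.symm⟩
  have hl2 : P'.asIdeal.LiesOver v.asIdeal := ⟨hQ'c.symm⟩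
  have hsum := Ideal.sum_ramification_inertia (𝓞 L) K L (p := v.asIdeal) v.ne_bot
  rw [hL] at hsum
  have hm : ∀ R : PP L, R.asIdeal.LiesOver v.asIdeal → R.asIdeal ∈
      IsDedekindDomain.primesOverFinset v.asIdeal (𝓞 L) := by
    intro R hR
    rw [IsDedekindDomain.mem_primesOverFinset_iff v.ne_bot]
    exact ⟨R.isPrime, hR⟩
  have hpos : ∀ R : PP L, R.asIdeal.LiesOver v.asIdeal → 
      Ideal.inertiaDeg' v.asIdeal R.asIdeal ≤ 
      Ideal.ramificationIdx' v.asIdeal R.asIdeal * Ideal.inertiaDeg' v.asIdeal R.asIdeal ∧ 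
      1 ≤ Ideal.inertiaDeg' v.asIdeal R.asIdeal := by
    intro R hR
    constructor
    · refine Nat.le_mul_of_pos_left _ (Nat.pos_of_ne_zero ?_)
      have := R.isPrime
      exact Ideal.IsDedekindDomain.ramificationIdx'_ne_zero_of_liesOver _ v.ne_bot
    · have n1 := Ideal.absNorm_eq_pow_inertiaDeg'_of_liesOver R.asIdeal v.asIdeal v.isPrime v.ne_bot
      by_contra hlt
      rw [show Ideal.inertiaDeg' v.asIdeal R.asIdeal = 0 by omega, pow_zero] at n1
      have := absNorm_ge_two R
      omega
  have hne' : P.asIdeal ≠ P'.asIdeal := fun h => hPP (IsDedekindDomain.HeightOneSpectrum.ext h)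
  have hle : ∑ R ∈ {P.asIdeal, P'.asIdeal}, Ideal.ramificationIdx' v.asIdeal R *
      Ideal.inertiaDeg' v.asIdeal R ≤ 2 := by
    rw [← hsum]
    apply Finset.sum_le_sum_of_subset
    intro R hR
    rw [Finset.mem_insert, Finset.mem_singleton] at hR
    rcases hR with rfl | rfl
    · exact hm P hl1
    · exact hm P' hl2
  rw [Finset.sum_pair hne'] at hle
  have p1 := hpos P hl1
  have p2 := hpos P' hl2
  have f1 : Ideal.inertiaDeg' v.asIdeal P.asIdeal = 1 := by omega
  have f2 : Ideal.inertiaDeg' v.asIdeal P'.asIdeal = 1 := by omega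
  have n1 := Ideal.absNorm_eq_pow_inertiaDeg'_of_liesOver P.asIdeal v.asIdeal v.isPrime v.ne_bot
  have n2 := Ideal.absNorm_eq_pow_inertiaDeg'_of_liesOver P'.asIdeal v.asIdeal v.isPrime v.ne_bot
  rw [f1, pow_one] at n1
  rw [f2, pow_one] at n2
  exact ⟨P, P', hPP, hQc, hQ'c, n1.le, n2.le⟩

lemma exists_nonres_aux (u : 𝓞 K) (s : L) (hs : s * s = algebraMap K L u)
    (hL : finrank K L = 2) (σ : L ≃ₐ[K] L) (hσ : σ s = -s) (hu : u ≠ 0) (B : Set (PP K))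
    (hB : B.Finite) : ∃ v : PP K, v ∉ B ∧ (2 : 𝓞 K) ∉ v.asIdeal ∧ u ∉ v.asIdeal ∧
      ∀ a : 𝓞 K, u - a * a ∉ v.asIdeal := by
  classical
  have hInt : IsIntegral ℤ s := by
    have h1 : IsIntegral ℤ (s ^ 2) := by
      rw [sq, hs]
      exact (RingOfIntegers.isIntegral_coe u).algebraMap
    exact h1.of_pow two_pos
  let s' : 𝓞 L := ⟨s, hInt⟩
  let σ' : 𝓞 L ≃ₐ[𝓞 K] 𝓞 L := AlgEquiv.ofRingEquiv (f := RingOfIntegers.mapRingEquiv σ.toRingEquiv)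
    (by
      intro x
      apply RingOfIntegers.ext
      change σ (algebraMap K L x) = algebraMap K L x
      exact σ.commutes _)
  have hfin : ∀ x : 𝓞 K, x ≠ 0 → {v : PP K | x ∈ v.asIdeal}.Finite := by
    intro x hx
    have := Ideal.finite_factors (I := Ideal.span {x}) (by simpa using hx)
    refine this.subset fun v hv => ?_
    simpa [Ideal.dvd_iff_le, Ideal.span_singleton_le_iff_mem] using hv
  by_contra! hcon
  let B' : Set (PP K) := B ∪ {v | 2 ∈ v.asIdeal} ∪ {v | u ∈ v.asIdeal}
  have hB' : B'.Finite := (hB.union (hfin 2 two_ne_zero)).union (hfin u hu)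
  have key : ∀ v : (B'ᶜ : Set (PP K)), ∃ P P' : PP L, P ≠ P' ∧
      P.asIdeal.comap (algebraMap (𝓞 K) (𝓞 L)) = v.1.asIdeal ∧
      P'.asIdeal.comap (algebraMap (𝓞 K) (𝓞 L)) = v.1.asIdeal ∧
      Ideal.absNorm P.asIdeal ≤ Ideal.absNorm v.1.asIdeal ∧
      Ideal.absNorm P'.asIdeal ≤ Ideal.absNorm v.1.asIdeal := by
    rintro ⟨v, hv⟩
    have hv1 : v ∉ B := fun h => hv (Or.inl (Or.inl h))
    have hv2 : 2 ∉ v.asIdeal := fun h => hv (Or.inl (Or.inr h))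
    have hv3 : u ∉ v.asIdeal := fun h => hv (Or.inr h)
    obtain ⟨a, ha⟩ := hcon v hv1 hv2 hv3
    exact split_prime u s' (RingOfIntegers.ext hs) hL σ' (RingOfIntegers.ext hσ) v hv2 hv3 a ha
  choose P P' hne h1 h2 h3 h4 using key
  refine no_split B' hB' P P' ?_ h3 h4
  have hc : ∀ v w : (B'ᶜ : Set (PP K)), ∀ R R' : PP L, R = R' →
      R.asIdeal.comap (algebraMap (𝓞 K) (𝓞 L)) = v.1.asIdeal →
      R'.asIdeal.comap (algebraMap (𝓞 K) (𝓞 L)) = w.1.asIdeal → v = w := by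
    rintro v w R _ rfl h h'
    apply Subtype.ext
    apply IsDedekindDomain.HeightOneSpectrum.ext
    rw [← h, ← h']
  rintro (v | v) (w | w) h
  · rw [hc v w _ _ h (h1 v) (h1 w)]
  · have := hc v w _ _ h (h1 v) (h2 w)
    subst this
    exact absurd h (hne v)
  · have := hc v w _ _ h (h2 v) (h1 w)
    subst this
    exact absurd h.symm (hne v)
  · rw [hc v w _ _ h (h2 v) (h2 w)]

lemma exists_nonres (u : 𝓞 K) (hu : ¬ IsSquare (u : K)) (B : Set (PP K))
    (hB : B.Finite) : ∃ v : PP K, v ∉ B ∧ (2 : 𝓞 K) ∉ v.asIdeal ∧ u ∉ v.asIdeal ∧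
      ∀ a : 𝓞 K, u - a * a ∉ v.asIdeal := by
  have hu0 : u ≠ 0 := by
    rintro rfl
    exact hu (by simp)
  let f : Polynomial K := Polynomial.X ^ 2 - Polynomial.C (u : K)
  have hf : Irreducible f := X_pow_sub_C_irreducible_of_prime Nat.prime_two (fun b hb => hu
    ⟨b, by rw [← hb, sq]⟩)
  have hfact : Fact (Irreducible f) := ⟨hf⟩
  have hf0 : f ≠ 0 := hf.ne_zero
  have hdeg : f.natDegree = 2 := Polynomial.natDegree_X_pow_sub_C
  let L := AdjoinRoot f
  have hfd : FiniteDimensional K L := (AdjoinRoot.powerBasis hf0).finite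
  have hfr : finrank K L = 2 := by
    rw [(AdjoinRoot.powerBasis hf0).finrank, AdjoinRoot.powerBasis_dim, hdeg]
  have hc : CharZero L := charZero_of_injective_algebraMap (algebraMap K L).injective
  have htow : IsScalarTower ℚ K L := inferInstance
  have hfq : FiniteDimensional ℚ L := FiniteDimensional.trans ℚ K L
  have hnf : NumberField L := {}
  let s : L := AdjoinRoot.root f
  have hs : s * s = algebraMap K L u := by
    have := AdjoinRoot.eval₂_root f
    simp only [f, Polynomial.eval₂_sub, Polynomial.eval₂_pow, Polynomial.eval₂_X,
      Polynomial.eval₂_C] at this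
    have h2 := sub_eq_zero.1 this
    exact (sq s).symm.trans h2
  let σ0 : L →ₐ[K] L := AdjoinRoot.liftAlgHom f (Algebra.ofId K L) (-s) (by
    simp only [f, Polynomial.eval₂_sub, Polynomial.eval₂_pow, Polynomial.eval₂_X,
      Polynomial.eval₂_C]
    rw [neg_sq, sq, hs]
    exact sub_self _)
  have hσ0 : σ0 s = -s := AdjoinRoot.liftAlgHom_root _ _ _ _
  exact exists_nonres_aux (L := L) u s hs hfr
    (AlgEquiv.ofBijective σ0 (Algebra.IsAlgebraic.algHom_bijective σ0)) hσ0 hu0 B hB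

end ee2
end Cub

open NumberField
namespace Cub
open Module
open scoped nonZeroDivisors

section ff1
set_option linter.unusedSectionVars false
variable {k : Type*} [Field k] [NumberField k]
open FractionalIdeal

open Classical in
noncomputable def cls (I : Ideal (𝓞 k)) : ClassGroup (𝓞 k) :=
  if h : I ≠ ⊥ then ClassGroup.mk0 ⟨I, mem_nonZeroDivisors_of_ne_zero h⟩ else 1

lemma cls_eq (I : Ideal (𝓞 k)) (h : I ≠ ⊥) :
    cls I = ClassGroup.mk0 ⟨I, mem_nonZeroDivisors_of_ne_zero h⟩ := by
  rw [cls, dif_pos h]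

lemma cls_mul (I J : Ideal (𝓞 k)) (hI : I ≠ ⊥) (hJ : J ≠ ⊥) : cls (I * J) = cls I * cls J := by
  rw [cls_eq I hI, cls_eq J hJ, cls_eq (I * J) (mul_ne_zero hI hJ), ← map_mul]
  rfl

lemma cls_top : cls (⊤ : Ideal (𝓞 k)) = 1 := by
  rw [cls_eq _ top_ne_bot, ClassGroup.mk0_eq_one_iff]; exact top_isPrincipal

lemma cls_pow (I : Ideal (𝓞 k)) (hI : I ≠ ⊥) (n : ℕ) : cls (I ^ n) = cls I ^ n := by
  induction n with
  | zero => rw [pow_zero, pow_zero, Ideal.one_eq_top, cls_top]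
  | succ n ih => rw [pow_succ, cls_mul _ _ (pow_ne_zero n hI) hI, ih, pow_succ]

lemma cls_prod {ι : Type*} (s : Finset ι) (f : ι → Ideal (𝓞 k)) (hf : ∀ i ∈ s, f i ≠ ⊥) :
    cls (∏ i ∈ s, f i) = ∏ i ∈ s, cls (f i) := by
  classical
  induction s using Finset.induction_on with
  | empty => rw [Finset.prod_empty, Finset.prod_empty, Ideal.one_eq_top, cls_top]
  | insert a s ha ih =>
    have h2 : ∀ i ∈ s, f i ≠ ⊥ := fun i hi => hf i (Finset.mem_insert_of_mem hi)
    rw [Finset.prod_insert ha, Finset.prod_insert ha,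
      cls_mul _ _ (hf a (Finset.mem_insert_self a s)) (Finset.prod_ne_zero_iff.2 h2), ih h2]

lemma cls_eq_cls (I J : Ideal (𝓞 k)) (hI : I ≠ ⊥) (hJ : J ≠ ⊥) (h : cls I = cls J) :
    ∃ y : k, y ≠ 0 ∧ spanSingleton (𝓞 k)⁰ y * (I : FI k) = (J : FI k) := by
  rw [cls_eq I hI, cls_eq J hJ, ClassGroup.mk0_eq_mk0_iff_exists_fraction_ring k] at h
  obtain ⟨y, hy, h⟩ := h
  exact ⟨y, hy, h⟩

lemma cls_eq_one (I : Ideal (𝓞 k)) (hI : I ≠ ⊥) (h : cls I = 1) :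
    ∃ x : 𝓞 k, x ≠ 0 ∧ I = Ideal.span {x} := by
  rw [cls_eq I hI, ClassGroup.mk0_eq_one_iff] at h
  obtain ⟨x, hx⟩ := h.principal
  refine ⟨x, ?_, hx⟩
  rintro rfl
  apply hI; rw [hx]; simp

lemma cls_span (x : 𝓞 k) (hx : x ≠ 0) : cls (Ideal.span {x}) = 1 := by
  rw [cls_eq _ (by simpa using hx), ClassGroup.mk0_eq_one_iff]
  exact ⟨x, rfl⟩

lemma cls_surj_coprime (C : ClassGroup (𝓞 k)) (m : Ideal (𝓞 k)) (hm : m ≠ ⊥) :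
    ∃ b : Ideal (𝓞 k), b ≠ ⊥ ∧ cls b = C ∧ b ⊔ m = ⊤ := by
  obtain ⟨⟨J, hJ'⟩, hJ⟩ := ClassGroup.mk0_surjective C⁻¹
  have hJ0 : J ≠ ⊥ := nonZeroDivisors.ne_zero hJ'
  rw [← cls_eq J hJ0] at hJ
  obtain ⟨a, ha⟩ := IsDedekindDomain.exists_sup_span_eq (I := J * m) (J := J) Ideal.mul_le_left
    (mul_ne_zero hJ0 hm)
  have h1 : Ideal.span {a} ≤ J := by rw [← ha]; exact le_sup_right
  obtain ⟨b, hb⟩ := Ideal.dvd_iff_le.2 h1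
  rw [hb, ← Ideal.mul_sup] at ha
  have h2 : m ⊔ b = ⊤ := by
    have : J * (m ⊔ b) = J * 1 := by rw [ha, mul_one]
    rw [← Ideal.one_eq_top]; exact mul_left_cancel₀ (show J ≠ 0 from hJ0) this
  by_cases hb0 : b = ⊥
  · rw [hb0, sup_bot_eq] at h2
    obtain ⟨⟨B, hB'⟩, hB⟩ := ClassGroup.mk0_surjective C
    have hB0 : B ≠ ⊥ := nonZeroDivisors.ne_zero hB'
    rw [← cls_eq B hB0] at hB
    exact ⟨B, hB0, hB, by rw [h2, sup_top_eq]⟩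
  · refine ⟨b, hb0, ?_, by rw [sup_comm]; exact h2⟩
    have ha0 : a ≠ 0 := by
      rintro rfl
      have : J * b = 0 := by rw [← hb]; simp
      exact (mul_ne_zero hJ0 hb0) this
    have := cls_span a ha0
    rw [hb, cls_mul _ _ hJ0 hb0, hJ, inv_mul_eq_one] at this
    exact this.symm

/-- There is a class `c` attached to `Dv` such that ... -/
lemma exists_good_class : ∃ d : ClassGroup (𝓞 k), ∀ T : Finset (PP k), (∀ v ∈ T, 2 ∉ v.asIdeal) →
    (∃ C : ClassGroup (𝓞 k), d * cls (∏ v ∈ T, v.asIdeal) = C ^ 2) → 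
    ∃ (β : k) (I : FI k), Good β I T := by
  obtain ⟨a, d, ha, hd⟩ := FractionalIdeal.exists_eq_spanSingleton_mul (Dv k)
  have hak : (a : k) ≠ 0 := by simpa using ha
  have hd0 : d ≠ ⊥ := by
    rintro rfl
    apply Dv_ne_zero (k := k)
    rw [hd]; simp
  refine ⟨cls d, fun T hT ⟨C, hC⟩ => ?_⟩
  obtain ⟨J, hJ0, hJ, -⟩ := cls_surj_coprime C ⊤ top_ne_bot
  rw [← hJ, ← cls_pow J hJ0, ← cls_mul _ _ hd0 (PP_prod_ne_bot T)] at hC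
  obtain ⟨y, hy, h⟩ := cls_eq_cls _ _ (pow_ne_zero 2 hJ0) (mul_ne_zero hd0 (PP_prod_ne_bot T)) hC.symm
  refine ⟨(a : k)⁻¹ * y, J, mul_ne_zero (inv_ne_zero hak) hy, coeIdeal_ne_zero.2 hJ0, ?_, hT⟩
  rw [hd, ← spanSingleton_mul_spanSingleton, mul_assoc, ← coeIdeal_pow, h, coeIdeal_mul]
  ring

lemma exists_T0 (C : ClassGroup (𝓞 k)) (m : Ideal (𝓞 k)) (hm : m ≠ ⊥) :
    ∃ T : Finset (PP k), (∀ v ∈ T, ¬ m ≤ v.asIdeal) ∧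
      ∃ C' : ClassGroup (𝓞 k), cls (∏ v ∈ T, v.asIdeal) = C * C' ^ 2 := by
  classical
  obtain ⟨b, hb0, hb, hbm⟩ := cls_surj_coprime C m hm
  obtain ⟨f, rfl⟩ := idl_surj b hb0
  refine ⟨f.support.filter (fun v => Odd (f v)), fun v hv hmv => ?_,
    (∏ v ∈ f.support, cls (v.asIdeal) ^ (f v / 2))⁻¹, ?_⟩
  · rw [Finset.mem_filter] at hv
    have h1 : idl k f ≤ v.asIdeal := by
      rw [← Ideal.dvd_iff_le, idl, Finsupp.prod]
      exact (dvd_pow_self _ (Finsupp.mem_support_iff.1 hv.1)).trans (Finset.dvd_prod_of_mem _ hv.1)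
    exact v.isPrime.ne_top (top_le_iff.1 (hbm ▸ sup_le h1 hmv))
  · rw [← hb, idl, Finsupp.prod, cls_prod _ _ (fun v _ => pow_ne_zero _ v.ne_bot),
      cls_prod _ _ (fun v _ => v.ne_bot), inv_pow, eq_mul_inv_iff_mul_eq, Finset.prod_filter,
      ← Finset.prod_pow, ← Finset.prod_mul_distrib]
    apply Finset.prod_congr rfl
    intro v _
    rw [cls_pow _ v.ne_bot, ← pow_mul]
    split_ifs with h
    · obtain ⟨n, hn⟩ := h
      rw [← pow_succ']; congr 1; omega
    · rw [Nat.not_odd_iff_even] at h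
      obtain ⟨n, hn⟩ := h
      rw [one_mul]; congr 1; omega

end ff1
end Cub

open NumberField
namespace Cub
open Module
open scoped nonZeroDivisors

section ff2
set_option linter.unusedSectionVars false

lemma two_torsion_basis (G : Type*) [CommGroup G] [Finite G] :
    ∃ (m : ℕ) (c : Fin m → G), (∀ j, c j ^ 2 = 1) ∧ 
      (∀ S : Finset (Fin m), ∏ j ∈ S, c j = 1 → S = ∅) ∧ 
      Nat.card (G ⧸ (powMonoidHom 2 : G →* G).range) = 2 ^ m := by
  classical
  let H := (powMonoidHom 2 : G →* G).ker
  have hH : ∀ x : Additive H, 2 • x = 0 := by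
    intro x
    have := (x.toMul).2
    rw [MonoidHom.mem_ker, powMonoidHom_apply] at this
    apply Additive.toMul.injective
    apply Subtype.ext
    simpa using this
  letI : Module (ZMod 2) (Additive H) := AddCommGroup.zmodModule hH
  have : Module.Finite (ZMod 2) (Additive H) := Module.Finite.of_finite
  let b := Module.finBasis (ZMod 2) (Additive H)
  refine ⟨finrank (ZMod 2) (Additive H), fun j => ((b j).toMul : G), fun j => ?_, fun S hS => ?_, ?_⟩
  · have := ((b j).toMul).2
    rwa [MonoidHom.mem_ker, powMonoidHom_apply] at this
  · have h1 : ∑ j ∈ S, b j = 0 := by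
      apply Additive.toMul.injective
      apply Subtype.ext
      rw [toMul_sum]
      simpa using hS
    by_contra hne
    obtain ⟨j, hj⟩ := Finset.nonempty_iff_ne_empty.2 hne
    have := linearIndependent_iff'.1 b.linearIndependent S (fun _ => 1) (by simpa using h1) j hj
    exact one_ne_zero this
  · change (powMonoidHom 2 : G →* G).range.index = _
    rw [Subgroup.index_range]
    change Nat.card (Additive H) = _
    rw [Module.natCard_eq_pow_finrank (K := ZMod 2), Nat.card_zmod]

end ff2
end Cub

open NumberField
namespace Cub
open Module
open scoped nonZeroDivisors

section ff3
set_option linter.unusedSectionVars false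
variable {k : Type*} [Field k] [NumberField k]

structure VU (u : 𝓞 k) : Prop where
  ne : u ≠ 0
  cop : Ideal.span {u} ⊔ Ideal.span {(2 : 𝓞 k)} = ⊤
  sq : ∃ q : Ideal (𝓞 k), Ideal.span {u} = q ^ 2
  norm : IsSquare (Algebra.norm ℚ (algebraMap (𝓞 k) k u))

lemma vu_of (h3 : finrank ℚ k = 3) (u : 𝓞 k) (hu : u ≠ 0) 
    (hc : Ideal.span {u} ⊔ Ideal.span {(2 : 𝓞 k)} = ⊤) (q : Ideal (𝓞 k))
    (hq : Ideal.span {u} = q ^ 2) : ∃ s : (𝓞 k)ˣ, (s = 1 ∨ s = -1) ∧ VU ((s : 𝓞 k) * u) := by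
  have h1 := Ideal.absNorm_span_singleton u
  rw [hq, map_pow] at h1
  have h2 : |Algebra.norm ℚ (u : k)| = (Ideal.absNorm q : ℚ) ^ 2 := by
    rw [← Algebra.coe_norm_int]
    have : (Algebra.norm ℤ u).natAbs = |Algebra.norm ℤ u| := Int.natCast_natAbs _
    rw [← h1] at this
    exact_mod_cast this.symm
  rcases abs_choice (Algebra.norm ℚ (u : k)) with h | h
  · refine ⟨1, Or.inl rfl, ?_⟩
    rw [Units.val_one, one_mul]
    exact ⟨hu, hc, ⟨q, hq⟩, ⟨Ideal.absNorm q, by rw [← sq, ← h2, h]⟩⟩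
  · refine ⟨-1, Or.inr rfl, ?_⟩
    have e : Ideal.span {((-1 : (𝓞 k)ˣ) : 𝓞 k) * u} = Ideal.span {u} := by
      rw [Units.val_neg, Units.val_one, neg_one_mul, Ideal.span_singleton_neg]
    refine ⟨by simpa using hu, by rw [e]; exact hc, ⟨q, by rw [e, hq]⟩, ⟨Ideal.absNorm q, ?_⟩⟩
    rw [← sq, ← h2, h, Units.val_neg, Units.val_one, neg_one_mul, map_neg,
      ← neg_one_mul, map_mul]
    have : Algebra.norm ℚ (-1 : k) = -1 := by
      have := Algebra.norm_algebraMap (S := k) (-1 : ℚ)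
      rw [h3] at this
      simpa [Odd.neg_one_pow (by decide : Odd 3)] using this
    rw [this, neg_one_mul]

lemma units_indep (s : Fin (Units.rank k) → (𝓞 k)ˣ) (hs : ∀ i, s i = 1 ∨ s i = -1)
    (S : Finset (Fin (Units.rank k))) (x : (𝓞 k)ˣ)
    (h : ∏ i ∈ S, s i * Units.fundSystem k i = x ^ 2) : S = ∅ := by
  classical
  have hs' : ∀ i, s i ∈ Units.torsion k := by
    intro i
    rcases hs i with h | h
    · rw [h]; exact one_mem _
    · rw [h, Units.torsion, CommGroup.mem_torsion, isOfFinOrder_iff_pow_eq_one]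
      exact ⟨2, by norm_num, by simp⟩
  have h1 : x ^ 2 = (∏ i ∈ S, s i) *
      ∏ i, Units.fundSystem k i ^ (if i ∈ S then (1 : ℤ) else 0) := by
    rw [← h, Finset.prod_mul_distrib]
    congr 1
    rw [← Finset.prod_subset (Finset.subset_univ S)]
    · exact Finset.prod_congr rfl fun i hi => by rw [if_pos hi, zpow_one]
    · intro i _ hi; rw [if_neg hi, zpow_zero]
  have h2 := Units.fun_eq_repr k (prod_mem fun i _ => hs' i) h1
  by_contra hne
  obtain ⟨j, hj⟩ := Finset.nonempty_iff_ne_empty.2 hne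
  obtain ⟨⟨ζ, f⟩, hf, -⟩ := Units.exist_unique_eq_mul_prod k x
  have h4 : x ^ 2 = (ζ : (𝓞 k)ˣ) ^ 2 * ∏ i, Units.fundSystem k i ^ (f i * 2) := by
    simp only [zpow_mul, Finset.prod_zpow]
    rw [hf, mul_pow]
    rfl
  have h5 := congrFun (h2.trans (Units.fun_eq_repr k (pow_mem ζ.2 2) h4).symm) j
  rw [if_pos hj] at h5
  omega

theorem exists_units (h3 : finrank ℚ k = 3) :
    ∃ m : ℕ, 
      Nat.card (ClassGroup (𝓞 k) ⧸ (powMonoidHom 2 : ClassGroup (𝓞 k) →* ClassGroup (𝓞 k)).range) = 2 ^ m ∧ 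
      ∃ u : Fin (Units.rank k) ⊕ Fin m → 𝓞 k, (∀ i, VU (u i)) ∧ 
        ∀ S : Finset (Fin (Units.rank k) ⊕ Fin m), IsSquare ((∏ i ∈ S, u i : 𝓞 k) : k) → S = ∅ := by
  classical
  obtain ⟨m, c, hc2, hcind, hcard⟩ := two_torsion_basis (ClassGroup (𝓞 k))
  refine ⟨m, hcard, ?_⟩
  have H1 : ∀ i : Fin (Units.rank k), ∃ s : (𝓞 k)ˣ, (s = 1 ∨ s = -1) ∧
      VU ((s : 𝓞 k) * (Units.fundSystem k i : 𝓞 k)) := fun i => by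
    have e : Ideal.span {(Units.fundSystem k i : 𝓞 k)} = ⊤ :=
      Ideal.span_singleton_eq_top.2 (Units.fundSystem k i).isUnit
    exact vu_of h3 _ (Units.ne_zero _) (by rw [e, top_sup_eq]) ⊤ (by rw [e, Ideal.top_pow])
  choose s hs hsV using H1
  have H2 : ∀ j : Fin m, ∃ (q : Ideal (𝓞 k)) (u : 𝓞 k), q ≠ ⊥ ∧ cls q = c j ∧ Ideal.span {u} = q ^ 2 ∧
      VU u := fun j => by
    obtain ⟨q, hq0, hq, hq2⟩ := cls_surj_coprime (c j) (Ideal.span {2}) span_two_ne_bot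
    obtain ⟨x, hx0, hx⟩ := cls_eq_one (q ^ 2) (pow_ne_zero 2 hq0) (by rw [cls_pow _ hq0, hq, hc2])
    obtain ⟨t, ht, hV⟩ := vu_of h3 x hx0 (by
      rw [← hx, sq]
      exact (Ideal.mul_sup_eq_of_coprime_left hq2).trans hq2) q hx.symm
    exact ⟨q, _, hq0, hq, by rw [hx, Ideal.span_singleton_mul_left_unit t.isUnit], hV⟩
  choose q γ hq0 hqc hγ hγV using H2
  refine ⟨Sum.elim (fun i => (s i : 𝓞 k) * (Units.fundSystem k i : 𝓞 k)) γ, ?_, ?_⟩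
  · rintro (i | j)
    · exact hsV i
    · exact hγV j
  · intro S hS
    obtain ⟨y, hy⟩ := hS
    obtain ⟨x, rfl⟩ : ∃ x : 𝓞 k, (x : k) = y := by
      apply IsIntegrallyClosed.exists_algebraMap_eq_of_isIntegral_pow (n := 2) (by norm_num)
      rw [sq, ← hy]
      exact RingOfIntegers.isIntegral_coe _ |>.tower_top
    rw [← co_mul] at hy
    have hy' := RingOfIntegers.ext hy
    rw [Finset.prod_sum_eq_prod_toLeft_mul_prod_toRight] at hy'
    simp only [Sum.elim_inl, Sum.elim_inr] at hy'
    have e1 : ∏ i ∈ S.toLeft, (s i : 𝓞 k) * (Units.fundSystem k i : 𝓞 k) =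
      ((∏ i ∈ S.toLeft, s i * Units.fundSystem k i : (𝓞 k)ˣ) : 𝓞 k) := by
      push_cast; rfl
    have e2 : Ideal.span {x} = ∏ j ∈ S.toRight, q j := by
      have : Ideal.span {x} ^ 2 = (∏ j ∈ S.toRight, q j) ^ 2 := by
        rw [Ideal.span_singleton_pow, sq, ← hy', e1,
          Ideal.span_singleton_mul_left_unit (Units.isUnit _), ← Ideal.prod_span_singleton,
          ← Finset.prod_pow]
        exact Finset.prod_congr rfl fun j _ => hγ j
      exact pow_left_injective two_ne_zero this
    have hx0 : x ≠ 0 := by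
      rintro rfl
      have : ∏ j ∈ S.toRight, q j ≠ 0 := Finset.prod_ne_zero_iff.2 fun j _ => hq0 j
      apply this
      rw [← e2]; simp
    have hR : S.toRight = ∅ := by
      apply hcind
      have := cls_span x hx0
      rw [e2, cls_prod _ _ fun j _ => hq0 j] at this
      simpa [hqc] using this
    rw [hR, Finset.prod_empty] at e2 hy'
    rw [Ideal.one_eq_top, Ideal.span_singleton_eq_top] at e2
    obtain ⟨x, rfl⟩ := e2
    have hL : S.toLeft = ∅ := by
      apply units_indep s hs _ x
      apply Units.ext
      rw [← e1, Units.val_pow_eq_pow_val, sq, ← hy', mul_one]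
    rw [← Finset.toLeft_disjSum_toRight (u := S), hL, hR]; simp

end ff3
end Cub

open NumberField
namespace Cub
open Module
open scoped nonZeroDivisors

section ff4
set_option linter.unusedSectionVars false
variable {k : Type*} [Field k] [NumberField k]

def sg (a : ZMod 2) : ℤ := if a = 0 then 1 else -1

lemma sg_add : ∀ a b : ZMod 2, sg (a + b) = sg a * sg b := by decide
lemma sg_inj : ∀ a b : ZMod 2, sg a = sg b → a = b := by decide
lemma sg_sq : ∀ a : ZMod 2, sg a * sg a = 1 := by decide
lemma sg_zero : sg 0 = 1 := by decide

lemma sg_sum {ι : Type*} (S : Finset ι) (c : ι → ZMod 2) : sg (∑ i ∈ S, c i) = ∏ i ∈ S, sg (c i) := by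
  classical
  induction S using Finset.induction_on with
  | empty => simp [sg_zero]
  | insert a s ha ih => rw [Finset.sum_insert ha, Finset.prod_insert ha, sg_add, ih]

lemma one_notin (v : PP k) : (1 : 𝓞 k) ∉ v.asIdeal := fun h =>
  v.isPrime.ne_top ((Ideal.eq_top_iff_one _).2 h)

lemma chi_one (v : PP k) : chi v (1 : 𝓞 k) = 1 := by
  have := chi_sq v 1 (one_notin v)
  rwa [mul_one] at this

lemma chi_prod {ι : Type*} (v : PP k) (S : Finset ι) (u : ι → 𝓞 k) :
    chi v (∏ i ∈ S, u i) = ∏ i ∈ S, chi v (u i) := by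
  classical
  induction S using Finset.induction_on with
  | empty => simp [chi_one]
  | insert a s ha ih => rw [Finset.prod_insert ha, Finset.prod_insert ha, chi_mul, ih]

lemma finite_div (x : 𝓞 k) (hx : x ≠ 0) : {v : PP k | x ∈ v.asIdeal}.Finite := by
  refine (Ideal.finite_factors (I := Ideal.span {x}) (by simpa using hx)).subset ?_
  intro v hv
  simpa [Ideal.dvd_iff_le, Ideal.span_singleton_le_iff_mem] using hv

lemma prod_symmDiff_pm {α : Type*} [DecidableEq α] (T T' : Finset α) (f : α → ℤ)
    (hf : ∀ v ∈ T, f v * f v = 1) :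
    ∏ v ∈ symmDiff T T', f v = (∏ v ∈ T, f v) * ∏ v ∈ T', f v := by
  have h1 : ∏ v ∈ T, f v = (∏ v ∈ T \ T', f v) * ∏ v ∈ T ∩ T', f v := by
    rw [mul_comm, Finset.prod_inter_mul_prod_diff]
  have h2 : ∏ v ∈ T', f v = (∏ v ∈ T' \ T, f v) * ∏ v ∈ T ∩ T', f v := by
    rw [mul_comm, Finset.inter_comm, Finset.prod_inter_mul_prod_diff]
  have h3 : (∏ v ∈ T ∩ T', f v) * ∏ v ∈ T ∩ T', f v = 1 := by
    rw [← Finset.prod_mul_distrib]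
    exact Finset.prod_eq_one fun v hv => hf v (Finset.mem_inter.1 hv).1
  have h4 : symmDiff T T' = (T \ T') ∪ (T' \ T) := rfl
  rw [h4, Finset.prod_union (by
    rw [Finset.disjoint_left]; intro a ha hb
    simp only [Finset.mem_sdiff] at ha hb; tauto), h1, h2]
  linear_combination -(∏ v ∈ T \ T', f v) * (∏ v ∈ T' \ T, f v) * h3

theorem chars_surj {ι : Type*} [Fintype ι] [DecidableEq ι] (u : ι → 𝓞 k) (hu0 : ∀ i, u i ≠ 0)
    (hind : ∀ S : Finset ι, IsSquare ((∏ i ∈ S, u i : 𝓞 k) : k) → S = ∅)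
    (c : ι → ZMod 2) : ∃ T : Finset (PP k), (∀ v ∈ T, 2 ∉ v.asIdeal ∧ ∀ i, u i ∉ v.asIdeal) ∧
      ∀ i, ∏ v ∈ T, chi v (u i) = sg (c i) := by
  classical
  let good : Set (PP k) := {v | 2 ∉ v.asIdeal ∧ ∀ i, u i ∉ v.asIdeal}
  let lam : PP k → ι → ZMod 2 := fun v i => if chi v (u i) = 1 then 0 else 1
  have hlam : ∀ v ∈ good, ∀ i, sg (lam v i) = chi v (u i) := by
    intro v hv i
    rcases chi_dichotomy v (u i) (hv.2 i) with h | h <;> simp only [lam, h] <;> decide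
  have htop : Submodule.span (ZMod 2) (lam '' good) = ⊤ := by
    by_contra hne
    obtain ⟨f, hf0, hf⟩ := Submodule.exists_le_ker_of_lt_top _ (lt_top_iff_ne_top.2 hne)
    let S : Finset ι := Finset.univ.filter fun i => f (Pi.single i 1) ≠ 0
    have hfS : ∀ c : ι → ZMod 2, f c = ∑ i ∈ S, c i := by
      intro c
      conv_lhs => rw [pi_eq_sum_univ' c, map_sum]
      rw [Finset.sum_filter]
      apply Finset.sum_congr rfl
      intro i _
      rw [map_smul, smul_eq_mul]
      have h01 : ∀ a b : ZMod 2, b * a = if a ≠ 0 then b else 0 := by decide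
      exact h01 _ _
    have hS : S ≠ ∅ := by
      intro hS
      apply hf0
      refine LinearMap.ext fun c => ?_
      rw [hfS, hS]; simp
    obtain ⟨v, hvB, hv2, hvu, hv⟩ := exists_nonres (∏ i ∈ S, u i) (fun h => hS (hind S h))
      (⋃ i, {v : PP k | u i ∈ v.asIdeal}) (Set.finite_iUnion fun i => finite_div _ (hu0 i))
    have hvg : v ∈ good := ⟨hv2, fun i hi => hvB (Set.mem_iUnion.2 ⟨i, hi⟩)⟩
    have h1 := chi_neg_one v _ hv2 hv
    rw [chi_prod, ← Finset.prod_congr rfl fun i _ => hlam v hvg i, ← sg_sum, ← hfS,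
      show f (lam v) = 0 from hf (Submodule.subset_span ⟨v, hvg, rfl⟩), sg_zero] at h1
    norm_num at h1
  have hc : c ∈ Submodule.span (ZMod 2) (lam '' good) := by rw [htop]; trivial
  change ∃ T : Finset (PP k), (∀ v ∈ T, v ∈ good) ∧ _
  induction hc using Submodule.span_induction with
  | mem x hx =>
    obtain ⟨v, hv, rfl⟩ := hx
    exact ⟨{v}, by simpa using hv, fun i => by rw [Finset.prod_singleton, hlam v hv]⟩
  | zero => exact ⟨∅, by simp, by simp [sg_zero]⟩
  | add x y _ _ hx hy =>
    obtain ⟨T, hT, hT'⟩ := hx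
    obtain ⟨R, hR, hR'⟩ := hy
    refine ⟨symmDiff T R, fun v hv => ?_, fun i => ?_⟩
    · rcases Finset.mem_symmDiff.1 hv with h | h
      · exact hT v h.1
      · exact hR v h.1
    · rw [prod_symmDiff_pm _ _ _ (fun v hv => by rw [← hlam v (hT v hv) i, sg_sq]), hT', hR',
        Pi.add_apply, sg_add]
  | smul a x _ hx =>
    obtain ⟨T, hT, hT'⟩ := hx
    have h01 : ∀ a : ZMod 2, a = 0 ∨ a = 1 := by decide
    rcases h01 a with rfl | rfl
    · exact ⟨∅, by simp, by simp [sg_zero]⟩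
    · exact ⟨T, hT, by simpa using hT'⟩

end ff4
end Cub

open NumberField
namespace Cub
open Module
open scoped nonZeroDivisors

section gg1
set_option linter.unusedSectionVars false
variable {k : Type*} [Field k] [NumberField k]

theorem exists_family {ι : Type*} [Fintype ι] [DecidableEq ι] (u : ι → 𝓞 k) (hu0 : ∀ i, u i ≠ 0)
    (hind : ∀ S : Finset ι, IsSquare ((∏ i ∈ S, u i : 𝓞 k) : k) → S = ∅) (r m : ℕ)
    (hι : Fintype.card ι = r + m)
    (hm : Nat.card (ClassGroup (𝓞 k) ⧸
      (powMonoidHom 2 : ClassGroup (𝓞 k) →* ClassGroup (𝓞 k)).range) = 2 ^ m) :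
    ∃ (A : Finset (ι → ZMod 2)) (β : (ι → ZMod 2) → k) (I : (ι → ZMod 2) → FI k)
      (T : (ι → ZMod 2) → Finset (PP k)) (e : ι → ℤ), 2 ^ r ≤ A.card ∧ 
      (∀ i, e i ≠ 0) ∧
      ∀ c ∈ A, Good (β c) (I c) (T c) ∧ (∀ v ∈ T c, ∀ i, u i ∉ v.asIdeal) ∧
        ∀ i, ∏ v ∈ T c, chi v (u i) = e i * sg (c i) := by
  classical
  choose T hT hTc using fun c : ι → ZMod 2 => chars_surj u hu0 hind c
  obtain ⟨d, hd⟩ := exists_good_class (k := k)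
  letI : Fintype (ClassGroup (𝓞 k) ⧸
      (powMonoidHom 2 : ClassGroup (𝓞 k) →* ClassGroup (𝓞 k)).range) := Fintype.ofFinite _
  obtain ⟨y, hy⟩ := Fintype.exists_le_card_fiber_of_mul_le_card (n := 2 ^ r)
    (fun c : ι → ZMod 2 => (QuotientGroup.mk (cls (∏ v ∈ T c, v.asIdeal)) : ClassGroup (𝓞 k) ⧸
      (powMonoidHom 2 : ClassGroup (𝓞 k) →* ClassGroup (𝓞 k)).range)) (by
      rw [← Nat.card_eq_fintype_card, hm, Fintype.card_fun, ZMod.card, hι, ← pow_add, add_comm])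
  obtain ⟨Y, rfl⟩ := QuotientGroup.mk_surjective y
  let M : Ideal (𝓞 k) := Ideal.span {2 * ∏ i, u i} * ∏ c : ι → ZMod 2, ∏ v ∈ T c, v.asIdeal
  have hM : M ≠ ⊥ := by
    apply mul_ne_zero
    · rw [Ne, Ideal.zero_eq_bot, Ideal.span_singleton_eq_bot]
      exact mul_ne_zero two_ne_zero (Finset.prod_ne_zero_iff.2 fun i _ => hu0 i)
    · exact Finset.prod_ne_zero_iff.2 fun c _ => PP_prod_ne_bot _
  obtain ⟨T0, hT0, C', hC'⟩ := exists_T0 ((d * Y)⁻¹) M hM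
  have h2 : ∀ v ∈ T0, 2 ∉ v.asIdeal := fun v hv h => hT0 v hv (Ideal.mul_le_left.trans
    ((Ideal.span_singleton_le_iff_mem _).2 (Ideal.mul_mem_right _ _ h)))
  have hu : ∀ v ∈ T0, ∀ i, u i ∉ v.asIdeal := fun v hv i h => hT0 v hv (Ideal.mul_le_left.trans
    ((Ideal.span_singleton_le_iff_mem _).2 (Ideal.mul_mem_left _ _
      (Ideal.mem_of_dvd _ (Finset.dvd_prod_of_mem u (Finset.mem_univ i)) h))))
  have hdis : ∀ c, Disjoint T0 (T c) := by
    intro c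
    rw [Finset.disjoint_left]
    intro v hv hvc
    apply hT0 v hv
    rw [← Ideal.dvd_iff_le]
    exact ((Finset.dvd_prod_of_mem (fun v : PP k => v.asIdeal) hvc).trans
      (Finset.dvd_prod_of_mem (fun c => ∏ v ∈ T c, v.asIdeal) (Finset.mem_univ c))).trans
      (dvd_mul_left _ _)
  have hG : ∀ c, (QuotientGroup.mk (cls (∏ v ∈ T c, v.asIdeal)) : ClassGroup (𝓞 k) ⧸
      (powMonoidHom 2 : ClassGroup (𝓞 k) →* ClassGroup (𝓞 k)).range) = QuotientGroup.mk Y →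
      ∃ (β : k) (I : FI k), Good β I (T0 ∪ T c) := by
    intro c hc
    apply hd
    · intro v hv
      rcases Finset.mem_union.1 hv with h | h
      · exact h2 v h
      · exact (hT c v h).1
    · obtain ⟨Z, hZ⟩ := (QuotientGroup.eq.1 hc.symm)
      rw [powMonoidHom_apply] at hZ
      refine ⟨C' * Z, ?_⟩
      rw [Finset.prod_union (hdis c), cls_mul _ _ (PP_prod_ne_bot _) (PP_prod_ne_bot _), hC',
        mul_pow, hZ, mul_inv]
      rw [← mul_left_inj Y, ← mul_left_inj d]
      have : ∀ a b c e : ClassGroup (𝓞 k), a * (a⁻¹ * b⁻¹ * c * e) = c * (b⁻¹ * e) := by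
        intro a b c e
        rw [mul_assoc, mul_assoc, mul_inv_cancel_left, mul_left_comm]
      rw [this]
  choose! β I hβ using hG
  refine ⟨Finset.univ.filter _, β, I, fun c => T0 ∪ T c, fun i => ∏ v ∈ T0, chi v (u i), hy, ?_, ?_⟩
  · intro i
    rcases prod_pm T0 _ fun v hv => chi_dichotomy v (u i) (hu v hv i) with h | h <;> simp [h]
  · intro c hc
    refine ⟨hβ c (Finset.mem_filter.1 hc).2, fun v hv => ?_, fun i => ?_⟩
    · rcases Finset.mem_union.1 hv with h | h
      · exact hu v h
      · exact (hT c v h).2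
    · rw [Finset.prod_union (hdis c), hTc]

end gg1
end Cub

open NumberField
namespace Cub
open Module
open scoped nonZeroDivisors

section gg2
set_option linter.unusedSectionVars false
variable {k : Type*} [Field k] [NumberField k]

lemma rank_pos (h3 : finrank ℚ k = 3) : 1 ≤ Units.rank k := by
  have h1 := InfinitePlace.card_add_two_mul_card_eq_rank k
  have h2 := InfinitePlace.card_eq_nrRealPlaces_add_nrComplexPlaces k
  rw [Units.rank]
  omega

open ComplexEmbedding in
lemma norm_prod (w : k) : ((Algebra.norm ℚ w : ℚ) : ℂ) = ∏ φ : k →+* ℂ, φ w := by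
  have h := Algebra.norm_eq_prod_embeddings ℚ ℂ w
  rw [show ((Algebra.norm ℚ w : ℚ) : ℂ) = algebraMap ℚ ℂ (Algebra.norm ℚ w) by simp, h]
  exact (Fintype.prod_equiv (RingHom.equivRatAlgHom k ℂ) _ _ fun φ => rfl).symm

open ComplexEmbedding in
lemma real_structure (h3 : finrank ℚ k = 3) (w : k) (hw : w ≠ 0) (hN : 0 < Algebra.norm ℚ w)
    (φ₀ : k →+* ℝ) (h0 : φ₀ w < 0) : Units.rank k = 2 ∧ ∃ φ₁ φ₂ φ₃ : k →+* ℝ,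
      (∀ φ, φ = φ₁ ∨ φ = φ₂ ∨ φ = φ₃) ∧ 0 < φ₁ w ∧ φ₂ w < 0 ∧ φ₃ w < 0 := by
  classical
  let P : k →+* ℂ := Complex.ofRealHom.comp φ₀
  have hPr : IsReal P := by
    rw [isReal_iff]
    ext x
    simp [P, conjugate_coe_eq]
  have hcard : (Finset.univ.erase P).card = 2 := by
    rw [Finset.card_erase_of_mem (Finset.mem_univ _), Finset.card_univ, Embeddings.card k ℂ, h3]
  obtain ⟨σ, τ, hne, hst⟩ := Finset.card_eq_two.1 hcard
  have hσP : σ ≠ P := Finset.ne_of_mem_erase (hst ▸ Finset.mem_insert_self σ {τ})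
  have hτP : τ ≠ P := Finset.ne_of_mem_erase (hst ▸ Finset.mem_insert_of_mem (Finset.mem_singleton_self τ))
  have hall : ∀ φ : k →+* ℂ, φ = P ∨ φ = σ ∨ φ = τ := by
    intro φ
    by_cases h : φ = P
    · exact Or.inl h
    · right
      have : φ ∈ Finset.univ.erase P := Finset.mem_erase.2 ⟨h, Finset.mem_univ _⟩
      rw [hst] at this
      simpa using this
  have hprod : ((Algebra.norm ℚ w : ℚ) : ℂ) = (φ₀ w : ℂ) * (σ w * τ w) := by
    rw [norm_prod, ← Finset.mul_prod_erase _ _ (Finset.mem_univ P), hst, Finset.prod_pair hne]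
    rfl
  have hconjP : ∀ φ, conjugate φ = P → φ = P := by
    intro φ h
    rw [← star_star φ]
    change star (conjugate φ) = P
    rw [h]; exact isReal_iff.1 hPr
  have key : ∀ σ τ : k →+* ℂ, σ ≠ P → (∀ φ : k →+* ℂ, φ = P ∨ φ = σ ∨ φ = τ) →
      ((Algebra.norm ℚ w : ℚ) : ℂ) = (φ₀ w : ℂ) * (σ w * τ w) → IsReal σ := by
    intro σ τ hσP hall hprod
    by_contra hσ
    have hc : conjugate σ = τ := by
      rcases hall (conjugate σ) with h | h | h
      · exact absurd (hconjP _ h) hσP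
      · exact absurd (isReal_iff.2 h) hσ
      · exact h
    rw [← hc, conjugate_coe_eq, Complex.mul_conj] at hprod
    have h1 : ((Algebra.norm ℚ w : ℚ) : ℝ) = φ₀ w * Complex.normSq (σ w) := by exact_mod_cast hprod
    have h2 : 0 ≤ Complex.normSq (σ w) := Complex.normSq_nonneg _
    have h4 : (0 : ℝ) < ((Algebra.norm ℚ w : ℚ) : ℝ) := by exact_mod_cast hN
    nlinarith
  have hσr := key σ τ hσP hall hprod
  have hτr := key τ σ hτP (fun φ => by have := hall φ; tauto) (by rw [hprod, mul_comm (σ w)])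
  have hallr : ∀ φ : k →+* ℂ, IsReal φ := by
    intro φ
    rcases hall φ with h | h | h <;> rw [h] <;> assumption
  refine ⟨?_, ?_⟩
  · have h1 := InfinitePlace.card_add_two_mul_card_eq_rank k
    have h2 := InfinitePlace.card_eq_nrRealPlaces_add_nrComplexPlaces k
    have h4 := InfinitePlace.card_complex_embeddings k
    have h5 : Fintype.card { φ : k →+* ℂ // ¬ IsReal φ } = 0 := by
      rw [Fintype.card_eq_zero_iff]
      exact ⟨fun φ => φ.2 (hallr φ.1)⟩
    rw [Units.rank]
    omega
  · have hs : ∀ x, ((hσr.embedding x : ℝ) : ℂ) = σ x := fun x => hσr.coe_embedding_apply x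
    have ht : ∀ x, ((hτr.embedding x : ℝ) : ℂ) = τ x := fun x => hτr.coe_embedding_apply x
    have hallR : ∀ φ : k →+* ℝ, φ = φ₀ ∨ φ = hσr.embedding ∨ φ = hτr.embedding := by
      intro φ
      rcases hall (Complex.ofRealHom.comp φ) with h | h | h
      · left; ext x; exact Complex.ofReal_injective (DFunLike.congr_fun h x)
      · right; left; ext x; exact Complex.ofReal_injective ((DFunLike.congr_fun h x).trans (hs x).symm)
      · right; right; ext x; exact Complex.ofReal_injective ((DFunLike.congr_fun h x).trans (ht x).symm)
    rw [← hs, ← ht] at hprod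
    have h1 : ((Algebra.norm ℚ w : ℚ) : ℝ) = φ₀ w * (hσr.embedding w * hτr.embedding w) := by
      exact_mod_cast hprod
    have h4 : (0 : ℝ) < ((Algebra.norm ℚ w : ℚ) : ℝ) := by exact_mod_cast hN
    have h5 : hσr.embedding w * hτr.embedding w < 0 := by
      by_contra h; push Not at h; nlinarith
    rcases mul_neg_iff.1 h5 with h | h
    · exact ⟨hσr.embedding, φ₀, hτr.embedding, fun φ => by have := hallR φ; tauto, h.1, h0, h.2⟩
    · exact ⟨hτr.embedding, φ₀, hσr.embedding, fun φ => by have := hallR φ; tauto, h.2, h0, h.1⟩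

end gg2
end Cub

open NumberField
namespace Cub
open Module
open scoped nonZeroDivisors

section gg3
set_option linter.unusedSectionVars false
variable {k : Type*} [Field k] [NumberField k]

theorem main (h3 : finrank ℚ k = 3) : ∃ u : 𝓞 k, VU u ∧ u - 1 ∉ Ideal.span {(4 : 𝓞 k)} := by
  classical
  by_contra hcon
  push Not at hcon
  obtain ⟨m, hm, u, huV, hind⟩ := exists_units h3
  obtain ⟨A, β, I, T, e, hA, he, hG⟩ := exists_family u (fun i => (huV i).ne) hind (Units.rank k) m
    (by simp) hm
  have hfin : ∀ c ∈ A, ∀ c' ∈ A,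
      (∀ i, ∏ v ∈ T c, chi v (u i) = ∏ v ∈ T c', chi v (u i)) → c = c' := by
    intro c hc c' hc' h
    funext i
    have := h i
    rw [(hG c hc).2.2 i, (hG c' hc').2.2 i] at this
    exact sg_inj _ _ (mul_left_cancel₀ (he i) this)
  by_cases hpos : ∀ i, ∀ φ : k →+* ℝ, 0 < φ (u i)
  · have h2 : 1 < A.card := lt_of_lt_of_le (Nat.one_lt_two_pow (by have := rank_pos h3; omega)) hA
    obtain ⟨c, hc, c', hc', hne⟩ := Finset.one_lt_card.1 h2
    apply hne
    apply hfin c hc c' hc'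
    intro i
    obtain ⟨q, hq⟩ := (huV i).sq
    rw [cons1 (hG c hc).1 (u i) (huV i).ne (hcon _ (huV i)) (fun v hv => (hG c hc).2.1 v hv i) q hq
      (hpos i), cons1 (hG c' hc').1 (u i) (huV i).ne (hcon _ (huV i))
      (fun v hv => (hG c' hc').2.1 v hv i) q hq (hpos i)]
  · push Not at hpos
    obtain ⟨i₀, φ₀, h0⟩ := hpos
    have hwk : (u i₀ : k) ≠ 0 := by simpa using (huV i₀).ne
    obtain ⟨qw, hqw⟩ := (huV i₀).sq
    have h0' : φ₀ (u i₀) < 0 := lt_of_le_of_ne h0 (by simpa using (huV i₀).ne)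
    have hN : 0 < Algebra.norm ℚ (u i₀ : k) := by
      obtain ⟨x, hx⟩ := (huV i₀).norm
      have h1 : Algebra.norm ℚ (u i₀ : k) ≠ 0 := by
        rw [Ne, Algebra.norm_eq_zero_iff]; exact hwk
      exact lt_of_le_of_ne (hx ▸ mul_self_nonneg x) h1.symm
    obtain ⟨hr, φ₁, φ₂, φ₃, hall, s1, s2, s3⟩ := real_structure h3 _ hwk hN φ₀ h0'
    have tw : ∀ c ∈ A, ∀ c' ∈ A, ∀ h : 𝓞 k, h ≠ 0 → (∃ q : Ideal (𝓞 k), Ideal.span {h} = q ^ 2) →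
        (∀ φ : k →+* ℝ, 0 < φ (β c' / β c) / φ h) → c = c' := by
      intro c hc c' hc' h hh ⟨q, hq⟩ hp
      apply hfin c hc c' hc'
      intro i
      obtain ⟨q', hq'⟩ := (huV i).sq
      refine cons2 ((hG c hc).1.twist h hh q hq) (hG c' hc').1 (u i) (huV i).ne (hcon _ (huV i))
        (fun v hv => (hG c hc).2.1 v hv i) (fun v hv => (hG c' hc').2.1 v hv i) q' hq' (fun φ => ?_)
      have := hp φ
      rwa [← map_div₀, div_div, mul_comm (β c)] at this
    have hcard : (Finset.univ : Finset Bool).card < A.card := by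
      have h4 : 2 ^ Units.rank k = 4 := by rw [hr]; norm_num
      rw [Finset.card_univ, Fintype.card_bool]
      omega
    obtain ⟨c, hc, c', hc', hne, heq⟩ := Finset.exists_ne_map_eq_of_card_lt_of_maps_to hcard
      (f := fun c => decide (0 < φ₂ (β c) * φ₃ (β c))) (fun _ _ => Finset.mem_univ _)
    apply hne
    have b0 := (hG c hc).1.hβ
    have b0' := (hG c' hc').1.hβ
    have n0 : ∀ φ : k →+* ℝ, φ (β c) ≠ 0 := fun φ => by simpa using b0
    have n0' : ∀ φ : k →+* ℝ, φ (β c') ≠ 0 := fun φ => by simpa using b0'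
    have ht0 : ∀ φ : k →+* ℝ, φ (β c' / β c) ≠ 0 := fun φ => by
      rw [map_div₀]; exact div_ne_zero (n0' φ) (n0 φ)
    have h23 : 0 < φ₂ (β c' / β c) * φ₃ (β c' / β c) := by
      have heq' : (0 < φ₂ (β c) * φ₃ (β c)) ↔ (0 < φ₂ (β c') * φ₃ (β c')) := by simpa using heq
      rw [map_div₀, map_div₀, div_mul_div_comm]
      by_cases h : 0 < φ₂ (β c) * φ₃ (β c)
      · exact div_pos (heq'.1 h) h
      · have h' := fun hh => h (heq'.2 hh)
        have a1 := lt_of_le_of_ne (not_lt.1 h) (mul_ne_zero (n0 φ₂) (n0 φ₃))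
        have a2 := lt_of_le_of_ne (not_lt.1 h') (mul_ne_zero (n0' φ₂) (n0' φ₃))
        exact div_pos_of_neg_of_neg a2 a1
    have all3 : ∀ p : (k →+* ℝ) → Prop, p φ₁ → p φ₂ → p φ₃ → ∀ φ, p φ := by
      intro p p1 p2 p3 φ
      rcases hall φ with h | h | h <;> rw [h] <;> assumption
    have hneg : Ideal.span {-u i₀} = qw ^ 2 := by rw [Ideal.span_singleton_neg, hqw]
    have h1s : Ideal.span {(1 : 𝓞 k)} = ⊤ ^ 2 := by rw [Ideal.top_pow, Ideal.span_singleton_one]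
    have h1n : Ideal.span {(-1 : 𝓞 k)} = ⊤ ^ 2 := by rw [Ideal.span_singleton_neg, h1s]
    have cn : ((-u i₀ : 𝓞 k) : k) = -(u i₀ : k) := rfl
    have cn1 : ((-1 : 𝓞 k) : k) = -1 := by simp
    rcases lt_or_gt_of_ne (ht0 φ₁) with t1 | t1 <;> rcases mul_pos_iff.1 h23 with ⟨t2, t3⟩ | ⟨t2, t3⟩
    · refine tw c hc c' hc' (-u i₀) (neg_ne_zero.2 (huV i₀).ne) ⟨qw, hneg⟩ (all3 _ ?_ ?_ ?_) <;>
        rw [cn, map_neg]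
      · exact div_pos_of_neg_of_neg t1 (by linarith)
      · exact div_pos t2 (by linarith)
      · exact div_pos t3 (by linarith)
    · refine tw c hc c' hc' (-1) (neg_ne_zero.2 one_ne_zero) ⟨⊤, h1n⟩ (all3 _ ?_ ?_ ?_) <;>
        rw [cn1, map_neg, map_one] <;> apply div_pos_of_neg_of_neg _ (by norm_num) <;> assumption
    · refine tw c hc c' hc' 1 one_ne_zero ⟨⊤, h1s⟩ (all3 _ ?_ ?_ ?_) <;>
        rw [co_one, map_one, div_one] <;> assumption
    · refine tw c hc c' hc' (u i₀) (huV i₀).ne ⟨qw, hqw⟩ (all3 _ ?_ ?_ ?_)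
      · exact div_pos t1 s1
      · exact div_pos_of_neg_of_neg t2 s2
      · exact div_pos_of_neg_of_neg t3 s3

end gg3
end Cub

/-- Let `k` be a cubic field.  There exists `u ∈ 𝓞 k`, coprime to `2`
(i.e. `u 𝓞 k + 2 𝓞 k = 𝓞 k`), such that `u 𝓞 k` is the square of an ideal of `𝓞 k`
(so `u` is a 2-virtual unit), `N_{k/ℚ}(u)` is a square in `ℚ`, and
`u` is not congruent to `1` modulo `4 𝓞 k`. -/
theorem statement14 (k : Type*) [Field k] [NumberField k]
    (h3 : Module.finrank ℚ k = 3) :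
    ∃ u : 𝓞 k,
      Ideal.span {u} ⊔ Ideal.span {(2 : 𝓞 k)} = ⊤ ∧
      (∃ q : Ideal (𝓞 k), Ideal.span {u} = q ^ 2) ∧
      IsSquare (Algebra.norm ℚ (algebraMap (𝓞 k) k u)) ∧
      u - 1 ∉ Ideal.span {(4 : 𝓞 k)} := by
  obtain ⟨u, hu, h4⟩ := Cub.main h3
  exact ⟨u, hu.cop, hu.sq, hu.norm, h4⟩
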